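/- arXiv:math/0611543 — 5 statements merged into one kernel-verified Lean document; each statement's English description precedes it below -/
import Mathlib

section
/- Suppose the external forces f_j are anti-symmetric, r_L and r_U satisfy r̃₂/2 < r_L < r_U and η′(r_U) + 13η′(2r_L) > 0, and η(r_L) + 4η(2r_L) − 2η(2r_U) < Φ_j < η(r_U) + 4η(2r_U) − 2η(2r_L) for every j = −N,…,N. Then for every symmetric rⁿ ∈ Ω = (r_L, r_U)^{2N+1} there is a unique symmetric rⁿ⁺¹ ∈ Ω with Ψ̂^E(rⁿ⁺¹) + Ψ̂^G(rⁿ) = Φ; the induced map on symmetric vectors satisfies ‖rⁿ⁺¹ − sⁿ⁺¹‖_∞ ≤ γ ‖rⁿ − sⁿ‖_∞ with γ = 8|η′(2r_L)| / (η′(r_U) − 5|η′(2r_L)|) < 1; and the iterates rⁿ converge to the unique symmetric solution r in Ω of the force-based quasicontinuum equilibrium equations F^{QCF}_j(r) + f_j = 0 for j = −N,…,N+1. -/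
open Finset Set

noncomputable section

/-- The `j`-th component (for `j ∈ [-N, N]`) of a vector in `ℝ^{2N+1}`. -/
def vcomp (N : ℕ) (r : Fin (2*N+1) → ℝ) (j : ℤ) : ℝ :=
  if h : (j + N).toNat < 2*N+1 then r ⟨(j + N).toNat, h⟩ else 0

/-- `η̂(r) = η(r) + 2 η(2r)`, the derivative of the energy density. -/
def etaHat (η : ℝ → ℝ) : ℝ → ℝ := fun r => η r + 2 * η (2*r)

/-- Structural assumptions on the atomistic potential (with `η = φ'`). -/
def Assump (η : ℝ → ℝ) (r1 r2 a0 a1 : ℝ) : Prop :=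
  0 < a0 ∧ a0 < r1 ∧ r1 < r2 ∧ r2 < 2*a0 ∧ a0 < a1 ∧
  (∀ r ∈ Ioo (0:ℝ) r1, 0 < deriv η r) ∧ (∀ r ∈ Ioi r1, deriv η r < 0) ∧
  (∀ r ∈ Ioo (0:ℝ) r2, deriv (deriv η) r < 0) ∧ (∀ r ∈ Ioi r2, 0 < deriv (deriv η) r) ∧
  (∀ r ∈ Ioo (0:ℝ) a0, etaHat η r < 0) ∧ (∀ r ∈ Ioi a0, 0 < etaHat η r) ∧
  (∀ r ∈ Ioo (0:ℝ) a1, 0 < deriv (etaHat η) r) ∧ (∀ r ∈ Ioi a1, deriv (etaHat η) r < 0)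

/-- The symmetrized force-based quasicontinuum conjugate-force map `Ψ̂^F`. -/
def PsiF (N K : ℕ) (η : ℝ → ℝ) (r : Fin (2*N+1) → ℝ) : Fin (2*N+1) → ℝ := fun i =>
  let j : ℤ := (i.val : ℤ) - (N : ℤ)
  let c := vcomp N r
  if -(K:ℤ)+1 ≤ j ∧ j ≤ (K:ℤ)-1 then
    η (c j) + η (c j + c (j-1)) + η (c j + c (j+1))
      + 2 * η (2 * c (K:ℤ)) - η (c (K:ℤ) + c ((K:ℤ)-1)) - η (c (K:ℤ) + c ((K:ℤ)+1))
  else η (c j) + 2 * η (2 * c j)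

/-- The symmetrized energy-based quasicontinuum conjugate-force map `Ψ̂^E`. -/
def PsiE (N K : ℕ) (η : ℝ → ℝ) (r : Fin (2*N+1) → ℝ) : Fin (2*N+1) → ℝ := fun i =>
  let j : ℤ := (i.val : ℤ) - (N : ℤ)
  let c := vcomp N r
  if j = -(K:ℤ)-1 then η (c j) + 2*η (2*c j) + (1/2)*η (c j + c (j+1))
  else if j = (K:ℤ)+1 then η (c j) + 2*η (2*c j) + (1/2)*η (c (j-1) + c j)
  else if j = -(K:ℤ) ∨ j = (K:ℤ) then
    η (c j) + η (2*c j) + (1/2)*η (c j + c (j-1)) + (1/2)*η (c j + c (j+1))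
  else if j = -(K:ℤ)+1 then η (c j) + (1/2)*η (c j + c (j-1)) + η (c j + c (j+1))
  else if j = (K:ℤ)-1 then η (c j) + η (c j + c (j-1)) + (1/2)*η (c j + c (j+1))
  else if -(K:ℤ)+2 ≤ j ∧ j ≤ (K:ℤ)-2 then η (c j) + η (c j + c (j-1)) + η (c j + c (j+1))
  else η (c j) + 2*η (2*c j)

/-- The ghost-force correction map `Ψ̂^G = Ψ̂^F - Ψ̂^E`. -/
def PsiG (N K : ℕ) (η : ℝ → ℝ) (r : Fin (2*N+1) → ℝ) : Fin (2*N+1) → ℝ :=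
  fun i => PsiF N K η r i - PsiE N K η r i

/-- The force-based quasicontinuum forces, with `r` given as a `ℤ`-indexed family. -/
def FQCFr (N K : ℕ) (η : ℝ → ℝ) (r : ℤ → ℝ) (j : ℤ) : ℝ :=
  if j = -(N:ℤ) then η (r j) + 2*η (2*r j)
  else if j = (N:ℤ)+1 then -(η (r (j-1)) + 2*η (2*r (j-1)))
  else if -(K:ℤ)+1 ≤ j ∧ j ≤ (K:ℤ) then
    (η (r j) + η (r j + r (j+1))) - (η (r (j-1)) + η (r (j-1) + r (j-2)))
  else (η (r j) + 2*η (2*r j)) - (η (r (j-1)) + 2*η (2*r (j-1)))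

/-- The Jacobian matrix of `Ψ̂^F`. -/
def Jac (N K : ℕ) (η : ℝ → ℝ) (r : Fin (2*N+1) → ℝ) :
    Matrix (Fin (2*N+1)) (Fin (2*N+1)) ℝ :=
  fun i j => deriv (fun t => PsiF N K η (Function.update r j t) i) (r j)

/-- Strict diagonal dominance with positive diagonal. -/
def SDD {m : ℕ} (A : Matrix (Fin m) (Fin m) ℝ) : Prop :=
  ∀ i, 0 < A i i ∧ ∑ j ∈ Finset.univ.erase i, |A i j| < A i i

/-- A vector `r ∈ ℝ^{2N+1}` is symmetric if `r_{-j} = r_j` for `1 ≤ j ≤ N`. -/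
def SymVec (N : ℕ) (r : Fin (2*N+1) → ℝ) : Prop :=
  ∀ j : ℤ, 1 ≤ j → j ≤ (N:ℤ) → vcomp N r (-j) = vcomp N r j

/-- Increments of `η` over `[rL, rU]` have slope in `[A, M]`, and those over `[2 rL, 2 rU]` have
slope in `[-D, 0]`. -/
structure SlopeBounds (η : ℝ → ℝ) (rL rU A M D : ℝ) : Prop where
  near : ∀ x ∈ Set.Icc rL rU, ∀ y ∈ Set.Icc rL rU,
    ∃ m ∈ Set.Icc A M, η x - η y = m * (x - y)
  far : ∀ x ∈ Set.Icc (2 * rL) (2 * rU), ∀ y ∈ Set.Icc (2 * rL) (2 * rU),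
    ∃ m ∈ Set.Icc 0 D, η x - η y = -(m * (x - y))

lemma exists_slope_of_deriv_mem {g : ℝ → ℝ} {l u lo hi : ℝ}
    (hd : ∀ x ∈ Set.Icc l u, DifferentiableAt ℝ g x)
    (hb : ∀ x ∈ Set.Icc l u, deriv g x ∈ Set.Icc lo hi)
    {x y : ℝ} (hx : x ∈ Set.Icc l u) (hy : y ∈ Set.Icc l u) :
    ∃ m ∈ Set.Icc lo hi, g x - g y = m * (x - y) := by
  wlog hxy : x ≤ y generalizing x y
  · obtain ⟨m, hm, he⟩ := this hy hx (le_of_not_ge hxy)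
    exact ⟨m, hm, by linarith⟩
  rcases hxy.eq_or_lt with rfl | hlt
  · exact ⟨deriv g x, hb x hx, by ring⟩
  · have hsub : ∀ z ∈ Set.Icc x y, z ∈ Set.Icc l u := fun z hz =>
      ⟨hx.1.trans hz.1, hz.2.trans hy.2⟩
    obtain ⟨c, hc, he⟩ := exists_deriv_eq_slope g hlt
      (fun z hz => (hd z (hsub z hz)).continuousAt.continuousWithinAt)
      (fun z hz => (hd z (hsub z (Set.Ioo_subset_Icc_self hz))).differentiableWithinAt)
    refine ⟨deriv g c, hb c (hsub c (Set.Ioo_subset_Icc_self hc)), ?_⟩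
    have : y - x ≠ 0 := by linarith
    field_simp at he
    linarith

lemma slopeBounds_of_assump {φ η : ℝ → ℝ} (hφ : ContDiffOn ℝ 3 φ (Set.Ioi 0)) (hη : η = deriv φ)
    {r1 r2 a0 a1 : ℝ} (hA : Assump η r1 r2 a0 a1) {rL rU : ℝ} (h1 : r2 / 2 < rL) (h2 : rL < rU)
    (h3 : 0 < deriv η rU + 13 * deriv η (2 * rL)) :
    deriv η (2 * rL) < 0 ∧
      SlopeBounds η rL rU (deriv η rU) (deriv η rL) (-deriv η (2 * rL)) := by
  obtain ⟨ha0, ha1, hr12, -, -, -, hneg, hconc, hconv, -⟩ := hA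
  have hηc : ContDiffOn ℝ 2 η (Set.Ioi 0) := by
    rw [hη]
    exact hφ.deriv_of_isOpen isOpen_Ioi (by norm_num)
  have hη' : ContDiffOn ℝ 1 (deriv η) (Set.Ioi 0) := hηc.deriv_of_isOpen isOpen_Ioi (by norm_num)
  have hd : ∀ x, 0 < x → DifferentiableAt ℝ η x := fun x hx =>
    (hηc.differentiableOn (by norm_num)).differentiableAt (Ioi_mem_nhds hx)
  have hd' : ∀ x, 0 < x → DifferentiableAt ℝ (deriv η) x := fun x hx =>
    (hη'.differentiableOn (by norm_num)).differentiableAt (Ioi_mem_nhds hx)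
  have hD : deriv η (2 * rL) < 0 := hneg _ (by simp only [Set.mem_Ioi]; linarith)
  have hrL : 0 < rL := by linarith
  have hrU : rU ≤ r1 := by
    by_contra! h
    have := hneg rU h
    linarith
  have hanti : AntitoneOn (deriv η) (Set.Icc rL rU) := by
    refine antitoneOn_of_deriv_nonpos (convex_Icc _ _)
      (fun x hx => (hd' x (hrL.trans_le hx.1)).continuousAt.continuousWithinAt) ?_ ?_ <;>
    · rw [interior_Icc]
      intro x hx
      first
      | exact (hd' x (hrL.trans hx.1)).differentiableWithinAt
      | exact (hconc x ⟨hrL.trans hx.1, by linarith [hx.2]⟩).le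
  have hmono : MonotoneOn (deriv η) (Set.Icc (2 * rL) (2 * rU)) := by
    refine monotoneOn_of_deriv_nonneg (convex_Icc _ _)
      (fun x hx => (hd' x (by linarith [hx.1])).continuousAt.continuousWithinAt) ?_ ?_ <;>
    · rw [interior_Icc]
      intro x hx
      first
      | exact (hd' x (by linarith [hx.1])).differentiableWithinAt
      | exact (hconv x (by simp only [Set.mem_Ioi]; linarith [hx.1])).le
  refine ⟨hD, fun x hx y hy => ?_, fun x hx y hy => ?_⟩
  · exact exists_slope_of_deriv_mem (fun z hz => hd z (hrL.trans_le hz.1))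
      (fun z hz => ⟨hanti hz ⟨h2.le, le_rfl⟩ hz.2, hanti ⟨le_rfl, h2.le⟩ hz hz.1⟩) hx hy
  · obtain ⟨m, hm, he⟩ := exists_slope_of_deriv_mem (g := η) (lo := deriv η (2 * rL)) (hi := 0)
      (fun z hz => hd z (by linarith [hz.1]))
      (fun z hz => ⟨hmono ⟨le_rfl, by linarith⟩ hz hz.1,
        (hneg z (by simp only [Set.mem_Ioi]; linarith [hz.1])).le⟩) hx hy
    exact ⟨-m, ⟨by linarith [hm.2], by linarith [hm.1]⟩, by linarith⟩

/-- The second-neighbour part of a conjugate force: a weighted combination of `η` at `2 r_i`,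
`r_i + r_p` and `r_i + r_q`. -/
def pairTerm {ι : Type*} (η : ℝ → ℝ) (α β δ : ℝ) (i p q : ι) (r : ι → ℝ) : ℝ :=
  α * η (2 * r i) + β * η (r i + r p) + δ * η (r i + r q)

/-- Every component is `η(r_i)` plus a second-neighbour term with nonnegative weights of total
at most `5/2`. -/
def HasPairRows {ι : Type*} (η : ℝ → ℝ) (Ψ : (ι → ℝ) → ι → ℝ) : Prop :=
  ∀ i, ∃ α β δ : ℝ, ∃ p q : ι, 0 ≤ α ∧ 0 ≤ β ∧ 0 ≤ δ ∧ α + β + δ ≤ 5 / 2 ∧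
    ∀ r, Ψ r i = η (r i) + pairTerm η α β δ i p q r

section Solve

variable {ι : Type*} {η : ℝ → ℝ} {rL rU A M D : ℝ} {Ψ : (ι → ℝ) → ι → ℝ}

lemma add_mem_Icc_two_mul {x y : ℝ} (hx : x ∈ Set.Icc rL rU) (hy : y ∈ Set.Icc rL rU) :
    x + y ∈ Set.Icc (2 * rL) (2 * rU) :=
  ⟨by linarith [hx.1, hy.1], by linarith [hx.2, hy.2]⟩

lemma two_mul_mem_Icc_two_mul {x : ℝ} (hx : x ∈ Set.Icc rL rU) :
    2 * x ∈ Set.Icc (2 * rL) (2 * rU) :=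
  ⟨by linarith [hx.1], by linarith [hx.2]⟩

/-- The damped Richardson step `x - (Ψ x)/M` acts on increments by nonnegative weights of total at
most `1 - (A - 5D)/M`. -/
lemma HasPairRows.relax_sub (hΨ : HasPairRows η Ψ) (hη : SlopeBounds η rL rU A M D)
    (hM : 0 < M) {x y : ι → ℝ}
    (hx : ∀ k, x k ∈ Set.Icc rL rU) (hy : ∀ k, y k ∈ Set.Icc rL rU) (i : ι) :
    ∃ u v w : ℝ, ∃ p q : ι, 0 ≤ u ∧ 0 ≤ v ∧ 0 ≤ w ∧ u + v + w ≤ 1 - (A - 5 * D) / M ∧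
      (x i - Ψ x i / M) - (y i - Ψ y i / M) =
        u * (x i - y i) + v * (x p - y p) + w * (x q - y q) := by
  obtain ⟨α, β, δ, p, q, hα, hβ, hδ, hsum, hrow⟩ := hΨ i
  obtain ⟨m, hm, e⟩ := hη.near _ (hx i) _ (hy i)
  obtain ⟨m₁, hm₁, e₁⟩ := hη.far _ (two_mul_mem_Icc_two_mul (hx i)) _
    (two_mul_mem_Icc_two_mul (hy i))
  obtain ⟨m₂, hm₂, e₂⟩ := hη.far _ (add_mem_Icc_two_mul (hx i) (hx p)) _
    (add_mem_Icc_two_mul (hy i) (hy p))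
  obtain ⟨m₃, hm₃, e₃⟩ := hη.far _ (add_mem_Icc_two_mul (hx i) (hx q)) _
    (add_mem_Icc_two_mul (hy i) (hy q))
  have b₁ : 0 ≤ α * m₁ ∧ α * m₁ ≤ α * D := ⟨mul_nonneg hα hm₁.1, by gcongr; exact hm₁.2⟩
  have b₂ : 0 ≤ β * m₂ ∧ β * m₂ ≤ β * D := ⟨mul_nonneg hβ hm₂.1, by gcongr; exact hm₂.2⟩
  have b₃ : 0 ≤ δ * m₃ ∧ δ * m₃ ≤ δ * D := ⟨mul_nonneg hδ hm₃.1, by gcongr; exact hm₃.2⟩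
  have hD : (α + β + δ) * D ≤ 5 / 2 * D :=
    mul_le_mul_of_nonneg_right hsum (hm₁.1.trans hm₁.2)
  refine ⟨(M - m + 2 * (α * m₁) + β * m₂ + δ * m₃) / M, β * m₂ / M, δ * m₃ / M, p, q,
    div_nonneg (by linarith [hm.2]) hM.le, div_nonneg b₂.1 hM.le, div_nonneg b₃.1 hM.le, ?_, ?_⟩
  · rw [← add_div, ← add_div, div_le_iff₀ hM, sub_mul, div_mul_cancel₀ _ hM.ne']
    linarith [hm.1]
  · rw [hrow, hrow, pairTerm, pairTerm]
    rw [div_mul_eq_mul_div, div_mul_eq_mul_div, div_mul_eq_mul_div, ← add_div, ← add_div,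
      eq_div_iff hM.ne', sub_mul, sub_mul, sub_mul, div_mul_cancel₀ _ hM.ne',
      div_mul_cancel₀ _ hM.ne']
    linear_combination -e - α * e₁ - β * e₂ - δ * e₃

variable [Fintype ι]

lemma HasPairRows.norm_relax_sub_le (hΨ : HasPairRows η Ψ) (hη : SlopeBounds η rL rU A M D)
    (hM : 0 < M) {x y : ι → ℝ}
    (hx : ∀ k, x k ∈ Set.Icc rL rU) (hy : ∀ k, y k ∈ Set.Icc rL rU) (i : ι) :
    |(x i - Ψ x i / M) - (y i - Ψ y i / M)| ≤ (1 - (A - 5 * D) / M) * ‖x - y‖ := by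
  obtain ⟨u, v, w, p, q, hu, hv, hw, hsum, he⟩ := hΨ.relax_sub hη hM hx hy i
  have hn : ∀ k, |x k - y k| ≤ ‖x - y‖ := fun k => norm_le_pi_norm (x - y) k
  rw [he]
  calc _ ≤ |u * (x i - y i)| + |v * (x p - y p)| + |w * (x q - y q)| := abs_add_three _ _ _
    _ ≤ u * ‖x - y‖ + v * ‖x - y‖ + w * ‖x - y‖ := by
      rw [abs_mul, abs_mul, abs_mul, abs_of_nonneg hu, abs_of_nonneg hv, abs_of_nonneg hw]
      gcongr <;> exact hn _
    _ = (u + v + w) * ‖x - y‖ := by ring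
    _ ≤ _ := by gcongr

lemma HasPairRows.norm_sub_le (hΨ : HasPairRows η Ψ) (hη : SlopeBounds η rL rU A M D)
    (hM : 0 < M) (hAM : A - 5 * D ≤ M) {x y : ι → ℝ}
    (hx : ∀ k, x k ∈ Set.Icc rL rU) (hy : ∀ k, y k ∈ Set.Icc rL rU) :
    (A - 5 * D) * ‖x - y‖ ≤ ‖Ψ x - Ψ y‖ := by
  have key : ‖x - y‖ ≤ (1 - (A - 5 * D) / M) * ‖x - y‖ + ‖Ψ x - Ψ y‖ / M := by
    have h0 : 0 ≤ 1 - (A - 5 * D) / M := by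
      rw [sub_nonneg, div_le_one hM]
      exact hAM
    refine (pi_norm_le_iff_of_nonneg (by positivity)).2 fun i => ?_
    have hΨi : |Ψ x i - Ψ y i| ≤ ‖Ψ x - Ψ y‖ := norm_le_pi_norm (Ψ x - Ψ y) i
    have hsplit : (x - y) i = ((x i - Ψ x i / M) - (y i - Ψ y i / M)) + (Ψ x i - Ψ y i) / M := by
      simp only [Pi.sub_apply]
      ring
    rw [hsplit, Real.norm_eq_abs]
    refine (abs_add_le _ _).trans (add_le_add (hΨ.norm_relax_sub_le hη hM hx hy i) ?_)
    rw [abs_div, abs_of_pos hM]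
    gcongr
  have : (A - 5 * D) / M * ‖x - y‖ ≤ ‖Ψ x - Ψ y‖ / M := by linarith
  rwa [div_mul_eq_mul_div, div_le_div_iff_of_pos_right hM] at this

/-- A Lipschitz self-map of a nonempty complete set with constant less than one has a fixed
point. -/
lemma exists_fixedPoint_of_norm_sub_le {E : Type*} [NormedAddCommGroup E] {s : Set E}
    (hs : IsComplete s) (hne : s.Nonempty) {T : E → E} (hT : Set.MapsTo T s s) {c : ℝ}
    (hc0 : 0 ≤ c) (hc1 : c < 1) (hc : ∀ x ∈ s, ∀ y ∈ s, ‖T x - T y‖ ≤ c * ‖x - y‖) :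
    ∃ x ∈ s, T x = x := by
  obtain ⟨x₀, hx₀⟩ := hne
  have hcontr : ContractingWith ⟨c, hc0⟩ (hT.restrict T s s) :=
    ⟨by exact_mod_cast hc1, LipschitzWith.of_dist_le_mul fun x y => by
      rw [Subtype.dist_eq, Subtype.dist_eq, dist_eq_norm, dist_eq_norm]
      exact hc x x.2 y y.2⟩
  obtain ⟨y, hy, hfix, -⟩ := hcontr.exists_fixedPoint' hs hT hx₀ (edist_ne_top _ _)
  exact ⟨y, hy, hfix⟩

lemma HasPairRows.exists_eq (hΨ : HasPairRows η Ψ) (hη : SlopeBounds η rL rU A M D)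
    (hM : 0 < M) (hAM : A - 5 * D ≤ M) (hAD : 0 < A - 5 * D) (hLU : rL ≤ rU) {b : ι → ℝ}
    (hL : ∀ i, Ψ (fun _ => rL) i < b i) (hU : ∀ i, b i < Ψ (fun _ => rU) i) :
    ∃ x : ι → ℝ, (∀ k, x k ∈ Set.Ioo rL rU) ∧ Ψ x = b := by
  set T : (ι → ℝ) → ι → ℝ := fun x i => x i - Ψ x i / M + b i / M with hTdef
  have hmaps : ∀ x : ι → ℝ, (∀ k, x k ∈ Set.Icc rL rU) → ∀ k, T x k ∈ Set.Ioo rL rU := by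
    intro x hx k
    constructor
    · obtain ⟨u, v, w, p, q, hu, hv, hw, -, he⟩ :=
        hΨ.relax_sub hη hM hx (y := fun _ => rL) (fun _ => ⟨le_rfl, hLU⟩) k
      have := mul_nonneg hu (sub_nonneg.2 (hx k).1)
      have := mul_nonneg hv (sub_nonneg.2 (hx p).1)
      have := mul_nonneg hw (sub_nonneg.2 (hx q).1)
      have := div_lt_div_of_pos_right (hL k) hM
      simp only [hTdef]
      linarith
    · obtain ⟨u, v, w, p, q, hu, hv, hw, -, he⟩ :=
        hΨ.relax_sub hη hM (x := fun _ => rU) (fun _ => ⟨hLU, le_rfl⟩) hx k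
      have := mul_nonneg hu (sub_nonneg.2 (hx k).2)
      have := mul_nonneg hv (sub_nonneg.2 (hx p).2)
      have := mul_nonneg hw (sub_nonneg.2 (hx q).2)
      have := div_lt_div_of_pos_right (hU k) hM
      simp only [hTdef]
      linarith
  have hbox : ∀ x : ι → ℝ, x ∈ Set.Icc (fun _ => rL) (fun _ => rU) ↔
      ∀ k, x k ∈ Set.Icc rL rU := fun x =>
    ⟨fun h k => ⟨h.1 k, h.2 k⟩, fun h => ⟨fun k => (h k).1, fun k => (h k).2⟩⟩
  have hc0 : 0 ≤ 1 - (A - 5 * D) / M := by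
    rw [sub_nonneg, div_le_one hM]
    exact hAM
  obtain ⟨x, hx, hfix⟩ := exists_fixedPoint_of_norm_sub_le
    (s := Set.Icc (fun _ : ι => rL) (fun _ => rU)) isClosed_Icc.isComplete
    ⟨fun _ => rL, (hbox _).2 fun _ => ⟨le_rfl, hLU⟩⟩ (T := T)
    (fun x hx => (hbox _).2 fun k => Set.Ioo_subset_Icc_self (hmaps x ((hbox x).1 hx) k)) hc0
    (by linarith [div_pos hAD hM]) (by
      intro x hx y hy
      refine (pi_norm_le_iff_of_nonneg (by positivity)).2 fun i => ?_
      have := hΨ.norm_relax_sub_le hη hM ((hbox x).1 hx) ((hbox y).1 hy) i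
      simpa [hTdef] using this)
  refine ⟨x, fun k => ?_, funext fun i => ?_⟩
  · have := hmaps x ((hbox x).1 hx) k
    rwa [hfix] at this
  · have := congrFun hfix i
    simp only [hTdef] at this
    field_simp at this
    linarith

end Solve

section Indexing

variable {N : ℕ}

lemma exists_vcomp_eq {j : ℤ} (h₁ : -(N : ℤ) ≤ j) (h₂ : j ≤ N) :
    ∃ p : Fin (2 * N + 1), ∀ r, vcomp N r j = r p := by
  have h : (j + N).toNat < 2 * N + 1 := by omega
  exact ⟨⟨_, h⟩, fun r => by rw [vcomp, dif_pos h]⟩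

lemma vcomp_val_sub (r : Fin (2 * N + 1) → ℝ) (i : Fin (2 * N + 1)) :
    vcomp N r ((i.val : ℤ) - N) = r i := by
  rw [vcomp, dif_pos (by omega)]
  congr 1
  ext
  dsimp only
  omega

lemma vcomp_comp_rev (r : Fin (2 * N + 1) → ℝ) {j : ℤ} (h₁ : -(N : ℤ) ≤ j) (h₂ : j ≤ N) :
    vcomp N (r ∘ Fin.rev) j = vcomp N r (-j) := by
  rw [vcomp, vcomp, dif_pos (by omega), dif_pos (by omega), Function.comp_apply]
  congr 1
  ext
  rw [Fin.val_rev]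
  dsimp only
  omega

lemma val_rev_sub (i : Fin (2 * N + 1)) :
    ((Fin.rev i).val : ℤ) - N = -((i.val : ℤ) - N) := by
  rw [Fin.val_rev]
  omega

lemma SymVec.vcomp_neg {r : Fin (2 * N + 1) → ℝ} (hr : SymVec N r) {j : ℤ}
    (h₁ : -(N : ℤ) ≤ j) (h₂ : j ≤ N) : vcomp N r (-j) = vcomp N r j := by
  rcases lt_trichotomy j 0 with h | rfl | h
  · simpa using (hr (-j) (by omega) (by omega)).symm
  · rfl
  · exact hr j (by omega) h₂

lemma symVec_iff_comp_rev {r : Fin (2 * N + 1) → ℝ} : SymVec N r ↔ r ∘ Fin.rev = r := by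
  constructor
  · intro hr
    funext i
    rw [← vcomp_val_sub (r ∘ Fin.rev) i, vcomp_comp_rev r (by omega) (by omega),
      hr.vcomp_neg (by omega) (by omega), vcomp_val_sub]
  · intro hr j h₁ h₂
    rw [← vcomp_comp_rev r (by omega) (by omega), hr]

lemma isClosed_symVec : IsClosed {r : Fin (2 * N + 1) → ℝ | SymVec N r} := by
  simp only [symVec_iff_comp_rev]
  exact isClosed_eq (by fun_prop) continuous_id

variable {K : ℕ} {η : ℝ → ℝ}

/-- `Ψ̂^E` commutes with reflection. -/
lemma PsiE_comp_rev (hKN : K + 2 ≤ N) (hK : 2 ≤ K) (r : Fin (2 * N + 1) → ℝ)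
    (i : Fin (2 * N + 1)) : PsiE N K η (r ∘ Fin.rev) i = PsiE N K η r (Fin.rev i) := by
  have hi := i.isLt
  simp only [PsiE, val_rev_sub]
  set j : ℤ := (i.val : ℤ) - N with hj
  have e₀ : vcomp N (r ∘ Fin.rev) j = vcomp N r (-j) :=
    vcomp_comp_rev r (by omega) (by omega)
  by_cases hout : j ≤ -(K : ℤ) - 2 ∨ (K : ℤ) + 2 ≤ j
  · rw [e₀]
    repeat rw [if_neg (by omega)]
  have e₁ : vcomp N (r ∘ Fin.rev) (j - 1) = vcomp N r (-j + 1) := by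
    rw [vcomp_comp_rev r (by omega) (by omega), neg_sub, sub_eq_neg_add]
  have e₂ : vcomp N (r ∘ Fin.rev) (j + 1) = vcomp N r (-j - 1) := by
    rw [vcomp_comp_rev r (by omega) (by omega), neg_add']
  rw [e₀, e₁, e₂]
  have hcases : j = -(K : ℤ) - 1 ∨ j = (K : ℤ) + 1 ∨ (j = -(K : ℤ) ∨ j = K) ∨
      j = -(K : ℤ) + 1 ∨ j = (K : ℤ) - 1 ∨ (-(K : ℤ) + 2 ≤ j ∧ j ≤ (K : ℤ) - 2) := by omega
  rcases hcases with h | h | h | h | h | h <;>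
    (repeat first | rw [if_pos (by omega)] | rw [if_neg (by omega)]) <;> ring_nf

lemma PsiF_rev_of_symVec (hKN : K + 2 ≤ N) {r : Fin (2 * N + 1) → ℝ} (hr : SymVec N r)
    (i : Fin (2 * N + 1)) : PsiF N K η r (Fin.rev i) = PsiF N K η r i := by
  have hi := i.isLt
  simp only [PsiF, val_rev_sub]
  set j : ℤ := (i.val : ℤ) - N with hj
  have e₀ : vcomp N r (-j) = vcomp N r j := hr.vcomp_neg (by omega) (by omega)
  by_cases hin : -(K : ℤ) + 1 ≤ j ∧ j ≤ (K : ℤ) - 1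
  · have e₁ : vcomp N r (-j - 1) = vcomp N r (j + 1) := by
      rw [← neg_add', hr.vcomp_neg (by omega) (by omega)]
    have e₂ : vcomp N r (-j + 1) = vcomp N r (j - 1) := by
      rw [← sub_eq_neg_add, ← neg_sub, hr.vcomp_neg (by omega) (by omega)]
    rw [if_pos hin, if_pos (by omega), e₀, e₁, e₂]
    ring
  · rw [if_neg hin, if_neg (by omega), e₀]

lemma PsiG_rev_of_symVec (hKN : K + 2 ≤ N) (hK : 2 ≤ K) {r : Fin (2 * N + 1) → ℝ}
    (hr : SymVec N r) (i : Fin (2 * N + 1)) :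
    PsiG N K η r (Fin.rev i) = PsiG N K η r i := by
  rw [PsiG, PsiG, PsiF_rev_of_symVec hKN hr, ← PsiE_comp_rev hKN hK, symVec_iff_comp_rev.1 hr]

/-- Row-wise form of `Ψ̂^E` and, on symmetric vectors, of `Ψ̂^G`. -/
lemma exists_pairTerm_rows (hKN : K + 2 ≤ N) (hK : 2 ≤ K) (i : Fin (2 * N + 1)) :
    ∃ α β δ a b d : ℝ, ∃ p q k p' q' : Fin (2 * N + 1),
      0 ≤ α ∧ 0 ≤ β ∧ 0 ≤ δ ∧ α + β + δ ≤ 5 / 2 ∧ 0 ≤ a ∧ 0 ≤ b ∧ 0 ≤ d ∧ b + d ≤ 2 ∧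
      a + b + d ≤ 4 ∧ α + β + δ + a = 2 + b + d ∧
      (∀ r, PsiE N K η r i = η (r i) + pairTerm η α β δ i p q r) ∧
      (∀ r, SymVec N r → PsiG N K η r i = pairTerm η a (-b) (-d) k p' q' r) := by
  have hi := i.isLt
  obtain ⟨j, hj⟩ : ∃ j : ℤ, (i.val : ℤ) - N = j := ⟨_, rfl⟩
  have e₀ : ∀ r, vcomp N r j = r i := fun r => hj ▸ vcomp_val_sub r i
  by_cases hout : j ≤ -(K : ℤ) - 2 ∨ (K : ℤ) + 2 ≤ j
  · refine ⟨2, 0, 0, 0, 0, 0, i, i, i, i, i, by norm_num, le_rfl, le_rfl, by norm_num, le_rfl,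
      le_rfl, le_rfl, by norm_num, by norm_num, by norm_num, fun r => ?_, fun r hr => ?_⟩
    · simp only [PsiE, pairTerm, hj]
      split_ifs <;> first | omega | (rw [e₀]; ring)
    · simp only [PsiG, PsiF, PsiE, pairTerm, hj]
      split_ifs <;> first | omega | ring
  obtain ⟨p, e₁⟩ := exists_vcomp_eq (N := N) (j := j - 1) (by omega) (by omega)
  obtain ⟨q, e₂⟩ := exists_vcomp_eq (N := N) (j := j + 1) (by omega) (by omega)
  obtain ⟨k, f₀⟩ := exists_vcomp_eq (N := N) (j := K) (by omega) (by omega)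
  obtain ⟨kp, f₁⟩ := exists_vcomp_eq (N := N) (j := (K : ℤ) - 1) (by omega) (by omega)
  obtain ⟨kq, f₂⟩ := exists_vcomp_eq (N := N) (j := (K : ℤ) + 1) (by omega) (by omega)
  by_cases hKm : j = -(K : ℤ) - 1
  · refine ⟨2, 0, 1 / 2, 0, 0, 1 / 2, p, q, i, p, q, by norm_num, by norm_num, by norm_num,
      by norm_num, by norm_num, by norm_num, by norm_num, by norm_num, by norm_num, by norm_num,
      fun r => ?_, fun r hr => ?_⟩
    · simp only [PsiE, pairTerm, hj, e₀, e₁, e₂]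
      split_ifs
      ring
    · simp only [PsiG, PsiF, PsiE, pairTerm, hj, e₀, e₁, e₂]
      split_ifs <;> first | omega | ring
  by_cases hKp : j = (K : ℤ) + 1
  · refine ⟨2, 1 / 2, 0, 0, 1 / 2, 0, p, q, i, p, q, by norm_num, by norm_num, by norm_num,
      by norm_num, by norm_num, by norm_num, by norm_num, by norm_num, by norm_num, by norm_num,
      fun r => ?_, fun r hr => ?_⟩
    · simp only [PsiE, pairTerm, hj, e₀, e₁, e₂]
      split_ifs
      rw [add_comm (r p)]; ring
    · simp only [PsiG, PsiF, PsiE, pairTerm, hj, e₀, e₁, e₂]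
      split_ifs <;> first | omega | (rw [add_comm (r p)]; ring)
  by_cases hKe : j = -(K : ℤ) ∨ j = K
  · refine ⟨1, 1 / 2, 1 / 2, 1, 1 / 2, 1 / 2, p, q, i, p, q, by norm_num, by norm_num,
      by norm_num, by norm_num, by norm_num, by norm_num, by norm_num, by norm_num, by norm_num,
      by norm_num, fun r => ?_, fun r hr => ?_⟩
    · simp only [PsiE, pairTerm, hj, e₀, e₁, e₂]
      split_ifs
      ring
    · simp only [PsiG, PsiF, PsiE, pairTerm, hj, e₀, e₁, e₂]
      split_ifs <;> first | omega | ring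
  by_cases hIm : j = -(K : ℤ) + 1
  · refine ⟨0, 1 / 2, 1, 2, 1 / 2, 1, p, q, k, kp, kq, by norm_num, by norm_num,
      by norm_num, by norm_num, by norm_num, by norm_num, by norm_num, by norm_num, by norm_num,
      by norm_num, fun r => ?_, fun r hr => ?_⟩
    · simp only [PsiE, pairTerm, hj, e₀, e₁, e₂]
      split_ifs
      ring
    · have s₀ : r i = r kp := by
        rw [← e₀ r, ← f₁ r, hIm, ← hr.vcomp_neg (by omega) (by omega), neg_add', neg_neg]
      have s₁ : r p = r k := by
        rw [← e₁ r, ← f₀ r, hIm, ← hr.vcomp_neg (by omega) (by omega), add_sub_cancel_right,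
          neg_neg]
      simp only [PsiG, PsiF, PsiE, pairTerm, hj, e₀, e₁, e₂, f₀, f₁, f₂]
      rw [s₀, s₁, add_comm (r kp) (r k)]
      split_ifs <;> first | omega | ring
  by_cases hIp : j = (K : ℤ) - 1
  · refine ⟨0, 1, 1 / 2, 2, 1 / 2, 1, p, q, k, kp, kq, by norm_num, by norm_num,
      by norm_num, by norm_num, by norm_num, by norm_num, by norm_num, by norm_num, by norm_num,
      by norm_num, fun r => ?_, fun r hr => ?_⟩
    · simp only [PsiE, pairTerm, hj, e₀, e₁, e₂]
      split_ifs
      ring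
    · have s₀ : r i = r kp := by rw [← e₀ r, ← f₁ r, hIp]
      have s₂ : r q = r k := by rw [← e₂ r, ← f₀ r, hIp, sub_add_cancel]
      simp only [PsiG, PsiF, PsiE, pairTerm, hj, e₀, e₁, e₂, f₀, f₁, f₂]
      rw [s₀, s₂, add_comm (r kp) (r k)]
      split_ifs <;> first | omega | ring
  · refine ⟨0, 1, 1, 2, 1, 1, p, q, k, kp, kq, by norm_num, by norm_num,
      by norm_num, by norm_num, by norm_num, by norm_num, by norm_num, by norm_num, by norm_num,
      by norm_num, fun r => ?_, fun r hr => ?_⟩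
    · simp only [PsiE, pairTerm, hj, e₀, e₁, e₂]
      split_ifs <;> first | omega | ring
    · simp only [PsiG, PsiF, PsiE, pairTerm, hj, e₀, e₁, e₂, f₀, f₁, f₂]
      split_ifs <;> first | omega | ring

lemma hasPairRows_PsiE (hKN : K + 2 ≤ N) (hK : 2 ≤ K) : HasPairRows η (PsiE N K η) := fun i => by
  obtain ⟨α, β, δ, -, -, -, p, q, -, -, -, hα, hβ, hδ, hsum, -, -, -, -, -, -, hE, -⟩ :=
    exists_pairTerm_rows (η := η) hKN hK i
  exact ⟨α, β, δ, p, q, hα, hβ, hδ, hsum, hE⟩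

variable {rL rU A M D : ℝ}

lemma SlopeBounds.far_mem (hη : SlopeBounds η rL rU A M D) (hLU : rL ≤ rU) {x : ℝ}
    (hx : x ∈ Set.Icc (2 * rL) (2 * rU)) : η x ∈ Set.Icc (η (2 * rU)) (η (2 * rL)) := by
  obtain ⟨m, hm, e⟩ := hη.far x hx (2 * rU) ⟨by linarith, le_rfl⟩
  obtain ⟨m', hm', e'⟩ := hη.far (2 * rL) ⟨le_rfl, by linarith⟩ x hx
  have := mul_nonneg hm.1 (sub_nonneg.2 hx.2)
  have := mul_nonneg hm'.1 (sub_nonneg.2 hx.1)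
  exact ⟨by linarith, by linarith⟩

lemma SlopeBounds.abs_far_sub_le (hη : SlopeBounds η rL rU A M D) {x y c : ℝ}
    (hx : x ∈ Set.Icc (2 * rL) (2 * rU)) (hy : y ∈ Set.Icc (2 * rL) (2 * rU))
    (hc : |x - y| ≤ c) : |η x - η y| ≤ D * c := by
  obtain ⟨m, hm, e⟩ := hη.far x hx y hy
  rw [e, abs_neg, abs_mul, abs_of_nonneg hm.1]
  exact mul_le_mul hm.2 hc (abs_nonneg _) (hm.1.trans hm.2)

/-- On symmetric vectors `Ψ̂^G` is Lipschitz with constant `8 D`. -/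
lemma norm_PsiG_sub_le (hKN : K + 2 ≤ N) (hK : 2 ≤ K) (hη : SlopeBounds η rL rU A M D)
    (hD : 0 ≤ D) {r s : Fin (2 * N + 1) → ℝ}
    (hr : ∀ k, r k ∈ Set.Icc rL rU) (hrs : SymVec N r)
    (hs : ∀ k, s k ∈ Set.Icc rL rU) (hss : SymVec N s) :
    ‖PsiG N K η r - PsiG N K η s‖ ≤ 8 * D * ‖r - s‖ := by
  refine (pi_norm_le_iff_of_nonneg (by positivity)).2 fun i => ?_
  obtain ⟨-, -, -, a, b, d, -, -, k, p, q, -, -, -, -, ha, hb, hd, -, hsum, -, -, hG⟩ :=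
    exists_pairTerm_rows (η := η) hKN hK i
  have hn : ∀ k, |r k - s k| ≤ ‖r - s‖ := fun k => norm_le_pi_norm (r - s) k
  have hpair : ∀ m, |(r k + r m) - (s k + s m)| ≤ 2 * ‖r - s‖ := fun m => by
    rw [add_sub_add_comm, two_mul]
    exact (abs_add_le _ _).trans (add_le_add (hn k) (hn m))
  have h₀ := hη.abs_far_sub_le (two_mul_mem_Icc_two_mul (hr k)) (two_mul_mem_Icc_two_mul (hs k))
    (c := 2 * ‖r - s‖) (by rw [two_mul, two_mul (s k)]; exact hpair k)
  have h₁ := hη.abs_far_sub_le (add_mem_Icc_two_mul (hr k) (hr p))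
    (add_mem_Icc_two_mul (hs k) (hs p)) (hpair p)
  have h₂ := hη.abs_far_sub_le (add_mem_Icc_two_mul (hr k) (hr q))
    (add_mem_Icc_two_mul (hs k) (hs q)) (hpair q)
  rw [Pi.sub_apply, hG r hrs, hG s hss, pairTerm, pairTerm, Real.norm_eq_abs]
  set c := D * (2 * ‖r - s‖) with hc
  have hc0 : 0 ≤ c := by positivity
  calc _ = |a * (η (2 * r k) - η (2 * s k)) + -b * (η (r k + r p) - η (s k + s p))
        + -d * (η (r k + r q) - η (s k + s q))| := by ring_nf
    _ ≤ a * c + b * c + d * c := by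
      refine (abs_add_three _ _ _).trans ?_
      rw [abs_mul, abs_mul, abs_mul, abs_neg, abs_neg, abs_of_nonneg ha, abs_of_nonneg hb,
        abs_of_nonneg hd]
      gcongr
    _ = (a + b + d) * c := by ring
    _ ≤ 4 * c := by gcongr
    _ = 8 * D * ‖r - s‖ := by rw [hc]; ring

lemma PsiE_const_add_PsiG_mem (hKN : K + 2 ≤ N) (hK : 2 ≤ K) (hη : SlopeBounds η rL rU A M D)
    (hLU : rL ≤ rU) {r : Fin (2 * N + 1) → ℝ}
    (hr : ∀ k, r k ∈ Set.Icc rL rU) (hrs : SymVec N r) (i : Fin (2 * N + 1)) :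
    PsiE N K η (fun _ => rL) i + PsiG N K η r i ≤ η rL + 4 * η (2 * rL) - 2 * η (2 * rU) ∧
      η rU + 4 * η (2 * rU) - 2 * η (2 * rL) ≤ PsiE N K η (fun _ => rU) i + PsiG N K η r i := by
  obtain ⟨α, β, δ, a, b, d, p₀, q₀, k, p, q, -, -, -, -, ha, hb, hd, hbd, -, hcons, hE, hG⟩ :=
    exists_pairTerm_rows (η := η) hKN hK i
  have h₀ := hη.far_mem hLU (two_mul_mem_Icc_two_mul (hr k))
  have h₁ := hη.far_mem hLU (add_mem_Icc_two_mul (hr k) (hr p))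
  have h₂ := hη.far_mem hLU (add_mem_Icc_two_mul (hr k) (hr q))
  rw [hE, hE, hG r hrs, pairTerm, pairTerm, pairTerm, ← two_mul, ← two_mul]
  have hα : α = 2 + b + d - a - β - δ := by linarith
  have hgap := mul_nonneg (sub_nonneg.2 hbd) (sub_nonneg.2 (h₀.1.trans h₀.2))
  subst hα
  constructor
  · have := mul_le_mul_of_nonneg_left h₀.2 ha
    have := mul_le_mul_of_nonneg_left h₁.1 hb
    have := mul_le_mul_of_nonneg_left h₂.1 hd
    linarith
  · have := mul_le_mul_of_nonneg_left h₀.1 ha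
    have := mul_le_mul_of_nonneg_left h₁.2 hb
    have := mul_le_mul_of_nonneg_left h₂.2 hd
    linarith

end Indexing

section Equilibrium

variable {N K : ℕ} {η : ℝ → ℝ} {f : ℤ → ℝ}

lemma sum_Icc_sub_one_add (f : ℤ → ℝ) {l j : ℤ} (h : l ≤ j) :
    ∑ i ∈ Finset.Icc l (j - 1), f i + f j = ∑ i ∈ Finset.Icc l j, f i := by
  rw [← Finset.insert_Icc_sub_one_right_eq_Icc h, Finset.sum_insert (by simp), add_comm]

lemma sum_Icc_neg_eq (hanti : ∀ j : ℤ, 0 ≤ j → j ≤ (N : ℤ) → f (j + 1) = -f (-j)) (n : ℕ)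
    (hn : n ≤ N) :
    ∑ i ∈ Finset.Icc (-(N : ℤ)) (-(n : ℤ)), f i = ∑ i ∈ Finset.Icc (-(N : ℤ)) n, f i := by
  induction n with
  | zero => simp
  | succ n ih =>
    have e₁ := sum_Icc_sub_one_add f (l := -(N : ℤ)) (j := -(n : ℤ)) (by omega)
    have e₂ := sum_Icc_sub_one_add f (l := -(N : ℤ)) (j := (n : ℤ) + 1) (by omega)
    have e₃ := hanti n (by omega) (by omega)
    have e₄ := ih (by omega)
    rw [add_sub_cancel_right] at e₂
    push_cast
    rw [neg_add']
    linarith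

/-- For anti-symmetric external forces the conjugate load `Φ` is symmetric. -/
lemma conjugate_load_rev (hanti : ∀ j : ℤ, 0 ≤ j → j ≤ (N : ℤ) → f (j + 1) = -f (-j))
    {Φ : Fin (2 * N + 1) → ℝ}
    (hΦ : ∀ i : Fin (2 * N + 1),
      Φ i = -(∑ i' ∈ Finset.Icc (-(N : ℤ)) ((i.val : ℤ) - (N : ℤ)), f i'))
    (i : Fin (2 * N + 1)) : Φ (Fin.rev i) = Φ i := by
  rw [hΦ, hΦ, val_rev_sub, neg_inj]
  have hi := i.isLt
  have habs := sum_Icc_neg_eq hanti ((i.val : ℤ) - N).natAbs (by omega)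
  rcases le_total 0 ((i.val : ℤ) - N) with h | h
  · rwa [Int.natCast_natAbs, abs_of_nonneg h] at habs
  · rw [Int.natCast_natAbs, abs_of_nonpos h, neg_neg] at habs
    exact habs.symm

/-- On symmetric vectors the force-based forces are the differences of the components of
`Ψ̂^F`. -/
lemma FQCFr_eq_sub (hKN : K + 2 ≤ N) (hK : 2 ≤ K) {r : Fin (2 * N + 1) → ℝ} (hr : SymVec N r)
    {i i' : Fin (2 * N + 1)} (hi : i.val = i'.val + 1) :
    FQCFr N K η (vcomp N r) ((i.val : ℤ) - N) = PsiF N K η r i - PsiF N K η r i' := by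
  have hlt := i.isLt
  have hj' : (i'.val : ℤ) - N = ((i.val : ℤ) - N) - 1 := by omega
  simp only [FQCFr, PsiF, hj']
  set j : ℤ := (i.val : ℤ) - N with hj
  have g₁ : j - 1 - 1 = j - 2 := by ring
  rw [if_neg (by omega), if_neg (by omega), sub_add_cancel, g₁]
  by_cases hl : j = -(K : ℤ) + 1
  · rw [if_pos (by omega), if_pos (by omega), if_neg (by omega)]
    have s₀ : vcomp N r j = vcomp N r ((K : ℤ) - 1) := by
      rw [← hr.vcomp_neg (by omega) (by omega)]
      congr 1
      omega
    have s₁ : vcomp N r (j - 1) = vcomp N r K := by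
      rw [← hr.vcomp_neg (by omega) (by omega)]
      congr 1
      omega
    have s₂ : vcomp N r (j - 2) = vcomp N r ((K : ℤ) + 1) := by
      rw [← hr.vcomp_neg (by omega) (by omega)]
      congr 1
      omega
    rw [s₀, s₁, s₂, add_comm (vcomp N r ((K : ℤ) - 1)) (vcomp N r K)]
    ring
  by_cases hu : j = K
  · rw [if_pos (by omega), if_neg (by omega), if_pos (by omega), hu,
      add_comm (vcomp N r ((K : ℤ) - 1)) (vcomp N r K)]
    ring
  by_cases hin : -(K : ℤ) + 1 ≤ j ∧ j ≤ K
  · rw [if_pos hin, if_pos (by omega), if_pos (by omega), add_comm (vcomp N r (j - 1)) (vcomp N r j)]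
    ring
  · rw [if_neg hin, if_neg (by omega), if_neg (by omega)]

lemma FQCFr_equilibrium_iff (hKN : K + 2 ≤ N) (hK : 2 ≤ K) {r : Fin (2 * N + 1) → ℝ}
    (hr : SymVec N r) (hsum : ∑ j ∈ Finset.Icc (-(N : ℤ)) ((N : ℤ) + 1), f j = 0)
    {Φ : Fin (2 * N + 1) → ℝ}
    (hΦ : ∀ i : Fin (2 * N + 1),
      Φ i = -(∑ i' ∈ Finset.Icc (-(N : ℤ)) ((i.val : ℤ) - (N : ℤ)), f i')) :
    (∀ j : ℤ, -(N : ℤ) ≤ j → j ≤ (N : ℤ) + 1 → FQCFr N K η (vcomp N r) j + f j = 0) ↔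
      PsiF N K η r = Φ := by
  have hfirst : FQCFr N K η (vcomp N r) (-(N : ℤ)) = PsiF N K η r 0 := by
    simp only [FQCFr, PsiF, Fin.val_zero, Nat.cast_zero, zero_sub]
    rw [if_pos trivial, if_neg (by omega)]
  have hΦfirst : Φ 0 = -f (-(N : ℤ)) := by simp [hΦ]
  have hΦstep : ∀ i i' : Fin (2 * N + 1), i.val = i'.val + 1 →
      Φ i = Φ i' - f ((i.val : ℤ) - N) := by
    intro i i' hi
    have hj' : (i'.val : ℤ) - N = ((i.val : ℤ) - N) - 1 := by omega
    rw [hΦ, hΦ, hj', ← sum_Icc_sub_one_add f (j := (i.val : ℤ) - N) (by omega)]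
    ring
  constructor
  · intro h
    have hall : ∀ n (hn : n < 2 * N + 1), PsiF N K η r ⟨n, hn⟩ = Φ ⟨n, hn⟩ := by
      intro n
      induction n with
      | zero =>
        intro hn
        have := h _ le_rfl (by omega)
        rw [hfirst] at this
        change PsiF N K η r 0 = Φ 0
        linarith
      | succ n ih =>
        intro hn
        have hn' : n < 2 * N + 1 := by omega
        have hF := FQCFr_eq_sub (η := η) hKN hK hr (i := ⟨n + 1, hn⟩) (i' := ⟨n, hn'⟩) rfl
        have hz := h (((⟨n + 1, hn⟩ : Fin (2 * N + 1)).val : ℤ) - N) (by dsimp only; omega)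
          (by dsimp only; omega)
        linarith [hΦstep ⟨n + 1, hn⟩ ⟨n, hn'⟩ rfl, ih hn']
    exact funext fun i => hall i i.isLt
  · intro h j hj₁ hj₂
    rcases hj₁.eq_or_lt with rfl | hlt
    · rw [hfirst, h, hΦfirst]
      ring
    rcases hj₂.eq_or_lt with rfl | hlt'
    · have hlast : FQCFr N K η (vcomp N r) ((N : ℤ) + 1) = -PsiF N K η r (Fin.last _) := by
        have hv : ((Fin.last (2 * N)).val : ℤ) - N = N := by
          rw [Fin.val_last]
          omega
        simp only [FQCFr, PsiF, hv]
        rw [if_neg (by omega), if_pos trivial, if_neg (by omega), add_sub_cancel_right]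
      have hv : ((Fin.last (2 * N)).val : ℤ) - N = (N : ℤ) + 1 - 1 := by
        rw [Fin.val_last]
        omega
      rw [← sum_Icc_sub_one_add f (by omega)] at hsum
      rw [hlast, h, hΦ, hv]
      linarith
    · have hF := FQCFr_eq_sub (η := η) hKN hK hr (i := ⟨(j + N).toNat, by omega⟩)
        (i' := ⟨(j + N).toNat - 1, by omega⟩) (by dsimp only; omega)
      have hs := hΦstep ⟨(j + N).toNat, by omega⟩ ⟨(j + N).toNat - 1, by omega⟩
        (by dsimp only; omega)
      have hj : ((j + N).toNat : ℤ) - N = j := by omega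
      dsimp only at hF hs
      rw [hj] at hF hs
      rw [hF, h, hs]
      ring

end Equilibrium

section Iteration

variable {N K : ℕ} {η : ℝ → ℝ} {rL rU A M D : ℝ} {Φ : Fin (2 * N + 1) → ℝ}

/-- A ghost-force step started in the closed box lands in the open box. -/
lemma exists_ghost_force_step (hKN : K + 2 ≤ N) (hK : 2 ≤ K) (hη : SlopeBounds η rL rU A M D)
    (hM : 0 < M) (hAM : A - 5 * D ≤ M) (hAD : 0 < A - 5 * D) (hLU : rL ≤ rU)
    (hΦs : ∀ i, Φ (Fin.rev i) = Φ i)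
    (hΦ : ∀ i, η rL + 4 * η (2 * rL) - 2 * η (2 * rU) < Φ i ∧
      Φ i < η rU + 4 * η (2 * rU) - 2 * η (2 * rL))
    {r : Fin (2 * N + 1) → ℝ} (hr : ∀ k, r k ∈ Set.Icc rL rU) (hrs : SymVec N r) :
    ∃ x, (∀ k, x k ∈ Set.Ioo rL rU) ∧ SymVec N x ∧
      ∀ i, PsiE N K η x i + PsiG N K η r i = Φ i := by
  have hE : HasPairRows η (PsiE N K η) := hasPairRows_PsiE hKN hK
  obtain ⟨x, hx, he⟩ := hE.exists_eq hη hM hAM hAD hLU (b := fun i => Φ i - PsiG N K η r i)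
    (fun i => by linarith [(PsiE_const_add_PsiG_mem hKN hK hη hLU hr hrs i).1, (hΦ i).1])
    (fun i => by linarith [(PsiE_const_add_PsiG_mem hKN hK hη hLU hr hrs i).2, (hΦ i).2])
  have hrev : PsiE N K η (x ∘ Fin.rev) = PsiE N K η x := funext fun i => by
    simp only [PsiE_comp_rev hKN hK, he]
    rw [hΦs, PsiG_rev_of_symVec hKN hK hrs]
  have hdist := hE.norm_sub_le hη hM hAM (x := x ∘ Fin.rev) (y := x)
    (fun k => Set.Ioo_subset_Icc_self (hx _)) (fun k => Set.Ioo_subset_Icc_self (hx k))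
  rw [hrev, sub_self, norm_zero] at hdist
  have hzero : ‖x ∘ Fin.rev - x‖ = 0 :=
    le_antisymm (nonpos_of_mul_nonpos_right hdist hAD) (norm_nonneg _)
  refine ⟨x, hx, symVec_iff_comp_rev.2 (sub_eq_zero.1 (norm_eq_zero.1 hzero)), fun i => ?_⟩
  rw [he, sub_add_cancel]

lemma norm_ghost_force_step_sub_le (hKN : K + 2 ≤ N) (hK : 2 ≤ K)
    (hη : SlopeBounds η rL rU A M D) (hM : 0 < M) (hAM : A - 5 * D ≤ M) (hAD : 0 < A - 5 * D)
    (hD : 0 ≤ D) {r s x y : Fin (2 * N + 1) → ℝ}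
    (hr : ∀ k, r k ∈ Set.Icc rL rU) (hrs : SymVec N r)
    (hs : ∀ k, s k ∈ Set.Icc rL rU) (hss : SymVec N s)
    (hx : ∀ k, x k ∈ Set.Icc rL rU) (hy : ∀ k, y k ∈ Set.Icc rL rU)
    (hrx : ∀ i, PsiE N K η x i + PsiG N K η r i = Φ i)
    (hsy : ∀ i, PsiE N K η y i + PsiG N K η s i = Φ i) :
    ‖x - y‖ ≤ 8 * D / (A - 5 * D) * ‖r - s‖ := by
  have hE := (hasPairRows_PsiE (η := η) hKN hK).norm_sub_le hη hM hAM hx hy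
  have hG := norm_PsiG_sub_le hKN hK hη hD hr hrs hs hss
  have heq : PsiE N K η x - PsiE N K η y = -(PsiG N K η r - PsiG N K η s) := funext fun i => by
    simp only [Pi.sub_apply, Pi.neg_apply]
    linarith [hrx i, hsy i]
  rw [heq, norm_neg] at hE
  rw [div_mul_eq_mul_div, le_div_iff₀ hAD]
  linarith

end Iteration

/-- Corollary (symmetric ghost force iteration): under anti-symmetric external forces and the
stated hypotheses, each ghost-force iteration step maps symmetric vectors in `Ω` to a unique
symmetric vector in `Ω`, the induced map is a contraction with the stated constant `< 1`, and
the iterates converge to the unique symmetric solution of the force-based quasicontinuum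
equilibrium equations. -/
theorem ghost_force_iteration_symmetric_convergence
    (N K : ℕ) (hK : 2 ≤ K) (hKN : K + 2 ≤ N)
    (φ η : ℝ → ℝ) (hφ : ContDiffOn ℝ 3 φ (Set.Ioi 0)) (hη : η = deriv φ)
    (r1 r2 a0 a1 : ℝ) (hA : Assump η r1 r2 a0 a1)
    (rL rU : ℝ) (h1 : r2/2 < rL) (h2 : rL < rU)
    (h3 : 0 < deriv η rU + 13 * deriv η (2*rL))
    (f : ℤ → ℝ)
    (hsum : ∑ j ∈ Finset.Icc (-(N:ℤ)) ((N:ℤ)+1), f j = 0)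
    (hanti : ∀ j : ℤ, 0 ≤ j → j ≤ (N:ℤ) → f (j+1) = - f (-j))
    (Φ : Fin (2*N+1) → ℝ)
    (hΦdef : ∀ i : Fin (2*N+1), Φ i = -(∑ i' ∈ Finset.Icc (-(N:ℤ)) ((i.val:ℤ) - (N:ℤ)), f i'))
    (hΦ : ∀ i, η rL + 4*η (2*rL) - 2*η (2*rU) < Φ i ∧
               Φ i < η rU + 4*η (2*rU) - 2*η (2*rL)) :
    ∃ rs : Fin (2*N+1) → ℝ,
      ((∀ k, rs k ∈ Ioo rL rU) ∧ SymVec N rs ∧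
        (∀ j : ℤ, -(N:ℤ) ≤ j → j ≤ (N:ℤ)+1 → FQCFr N K η (vcomp N rs) j + f j = 0)) ∧
      (∀ r' : Fin (2*N+1) → ℝ, ((∀ k, r' k ∈ Ioo rL rU) ∧ SymVec N r' ∧
        (∀ j : ℤ, -(N:ℤ) ≤ j → j ≤ (N:ℤ)+1 → FQCFr N K η (vcomp N r') j + f j = 0)) →
        r' = rs) ∧
      (∀ rn : Fin (2*N+1) → ℝ, (∀ k, rn k ∈ Ioo rL rU) → SymVec N rn →
        ∃! rn1 : Fin (2*N+1) → ℝ, (∀ k, rn1 k ∈ Ioo rL rU) ∧ SymVec N rn1 ∧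
          (∀ i, PsiE N K η rn1 i + PsiG N K η rn i = Φ i)) ∧
      8 * |deriv η (2*rL)| / (deriv η rU - 5 * |deriv η (2*rL)|) < 1 ∧
      (∀ rn sn rn1 sn1 : Fin (2*N+1) → ℝ,
        (∀ k, rn k ∈ Ioo rL rU) → SymVec N rn → (∀ k, sn k ∈ Ioo rL rU) → SymVec N sn →
        (∀ k, rn1 k ∈ Ioo rL rU) → SymVec N rn1 → (∀ k, sn1 k ∈ Ioo rL rU) → SymVec N sn1 →
        (∀ i, PsiE N K η rn1 i + PsiG N K η rn i = Φ i) →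
        (∀ i, PsiE N K η sn1 i + PsiG N K η sn i = Φ i) →
        ‖rn1 - sn1‖ ≤
          8 * |deriv η (2*rL)| / (deriv η rU - 5 * |deriv η (2*rL)|) * ‖rn - sn‖) ∧
      (∀ seq : ℕ → (Fin (2*N+1) → ℝ),
        (∀ n, (∀ k, seq n k ∈ Ioo rL rU) ∧ SymVec N (seq n)) →
        (∀ n, ∀ i, PsiE N K η (seq (n+1)) i + PsiG N K η (seq n) i = Φ i) →
        Filter.Tendsto seq Filter.atTop (nhds rs)) := by
  obtain ⟨hDneg, hηs⟩ := slopeBounds_of_assump hφ hη hA h1 h2 h3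
  rw [abs_of_neg hDneg]
  set A := deriv η rU
  set M := deriv η rL
  set D := -deriv η (2 * rL)
  have hD : 0 ≤ D := by linarith
  have hAD : 0 < A - 5 * D := by linarith
  have hAM : A - 5 * D ≤ M := by
    obtain ⟨m, hm, -⟩ := hηs.near rL ⟨le_rfl, h2.le⟩ rL ⟨le_rfl, h2.le⟩
    linarith [hm.1.trans hm.2]
  have hM : 0 < M := hAD.trans_le hAM
  set γ := 8 * D / (A - 5 * D) with hγ
  have hγ0 : 0 ≤ γ := by positivity
  have hγ1 : γ < 1 := by
    rw [hγ, div_lt_one hAD]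
    linarith
  have hexists := fun (r : Fin (2 * N + 1) → ℝ) (hr : ∀ k, r k ∈ Set.Icc rL rU)
      (hrs : SymVec N r) => exists_ghost_force_step hKN hK hηs hM hAM hAD h2.le
        (conjugate_load_rev hanti hΦdef) hΦ hr hrs
  have hopen : ∀ {r : Fin (2 * N + 1) → ℝ}, (∀ k, r k ∈ Set.Ioo rL rU) →
      ∀ k, r k ∈ Set.Icc rL rU := fun hr k => Set.Ioo_subset_Icc_self (hr k)
  have hcontr : ∀ {r s x y : Fin (2 * N + 1) → ℝ},
      (∀ k, r k ∈ Set.Icc rL rU) → SymVec N r → (∀ k, s k ∈ Set.Icc rL rU) → SymVec N s →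
      (∀ k, x k ∈ Set.Icc rL rU) → (∀ k, y k ∈ Set.Icc rL rU) →
      (∀ i, PsiE N K η x i + PsiG N K η r i = Φ i) →
      (∀ i, PsiE N K η y i + PsiG N K η s i = Φ i) → ‖x - y‖ ≤ γ * ‖r - s‖ :=
    norm_ghost_force_step_sub_le hKN hK hηs hM hAM hAD hD
  choose! T hT using hexists
  obtain ⟨rs, ⟨hrs, hrsym⟩, hfix⟩ := exists_fixedPoint_of_norm_sub_le
    (s := {r | (∀ k, r k ∈ Set.Icc rL rU) ∧ SymVec N r}) (T := T) (c := γ)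
    (by
      refine IsClosed.isComplete ?_
      rw [Set.ofPred_and, Set.ofPred_forall]
      exact (isClosed_iInter fun k => isClosed_Icc.preimage (continuous_apply k)).inter
        isClosed_symVec)
    ⟨fun _ => rL, fun _ => ⟨le_rfl, h2.le⟩, symVec_iff_comp_rev.2 rfl⟩
    (fun r hr => ⟨hopen (r := T r) (hT r hr.1 hr.2).1, (hT r hr.1 hr.2).2.1⟩) hγ0 hγ1
    (fun r hr s hs => hcontr (x := T r) (y := T s) hr.1 hr.2 hs.1 hs.2
      (hopen (r := T r) (hT r hr.1 hr.2).1) (hopen (r := T s) (hT s hs.1 hs.2).1)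
      (hT r hr.1 hr.2).2.2 (hT s hs.1 hs.2).2.2)
  obtain ⟨hrso, -, hrseq⟩ := hT rs hrs hrsym
  rw [hfix] at hrso hrseq
  have hFG : ∀ r : Fin (2 * N + 1) → ℝ,
      PsiF N K η r = Φ ↔ ∀ i, PsiE N K η r i + PsiG N K η r i = Φ i := fun r => by
    simp only [PsiG, add_sub_cancel, funext_iff]
  refine ⟨rs, ⟨hrso, hrsym, (FQCFr_equilibrium_iff hKN hK hrsym hsum hΦdef).2 ((hFG rs).2 hrseq)⟩,
    ?_, ?_, hγ1, ?_, ?_⟩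
  · rintro r' ⟨hr', hrsym', heq'⟩
    have hle := hcontr (hopen hr') hrsym' hrs hrsym (hopen hr') hrs
      ((hFG r').1 ((FQCFr_equilibrium_iff hKN hK hrsym' hsum hΦdef).1 heq')) hrseq
    have hzero : ‖r' - rs‖ = 0 := by nlinarith [norm_nonneg (r' - rs)]
    exact sub_eq_zero.1 (norm_eq_zero.1 hzero)
  · intro rn hrn hrnsym
    refine ⟨T rn, hT rn (hopen hrn) hrnsym, fun y hy => ?_⟩
    have hle := hcontr (hopen hrn) hrnsym (hopen hrn) hrnsym (hopen hy.1)
      (hopen (r := T rn) (hT rn (hopen hrn) hrnsym).1) hy.2.2 (hT rn (hopen hrn) hrnsym).2.2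
    rw [sub_self rn, norm_zero, mul_zero] at hle
    exact sub_eq_zero.1 (norm_le_zero_iff.1 hle)
  · intro rn sn rn1 sn1 hrn hrnsym hsn hsnsym hrn1 _ hsn1 _ hr hs
    exact hcontr (hopen hrn) hrnsym (hopen hsn) hsnsym (hopen hrn1) (hopen hsn1) hr hs
  · intro seq hseq hstep
    have hbound : ∀ n, ‖seq n - rs‖ ≤ γ ^ n * ‖seq 0 - rs‖ := by
      intro n
      induction n with
      | zero => simp
      | succ n ih =>
        calc _ ≤ γ * ‖seq n - rs‖ := hcontr (hopen (hseq n).1) (hseq n).2 hrs hrsym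
              (hopen (hseq (n + 1)).1) hrs (hstep n) hrseq
          _ ≤ γ * (γ ^ n * ‖seq 0 - rs‖) := by gcongr
          _ = _ := by ring
    refine tendsto_iff_norm_sub_tendsto_zero.2 (squeeze_zero (fun _ => norm_nonneg _) hbound ?_)
    simpa using (tendsto_pow_atTop_nhds_zero_of_lt_one hγ0 hγ1).mul_const ‖seq 0 - rs‖
end
end

section
/- Viewing the force-based quasicontinuum forces as functions of the representative-atom positions z (with unit mesh near the interface, so that r_K = z_{K+1} − z_K and r_{K+1} = z_{K+2} − z_{K+1}), one has ∂F^{QCF}_K/∂z_{K+1} = η′(r_K) and ∂F^{QCF}_{K+1}/∂z_K = η′(r_K) + 4η′(2r_K). Consequently, if η′(2(z_{K+1} − z_K)) ≠ 0 then the Jacobian of the force field F^{QCF} is not symmetric at z, and on any open set of increasing configurations z on which η′(2(z_{K+1} − z_K)) ≠ 0 there is no C² function E with F^{QCF}_j = −∂E/∂z_j for all j; i.e., the force-based quasicontinuum forces are nonconservative. -/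
open Finset Set

noncomputable section

/-- The `j`-th position (for `j ∈ [-N, N+1]`) of a configuration in `ℝ^{2N+2}`. -/
def czp (N : ℕ) (z : Fin (2*N+2) → ℝ) (j : ℤ) : ℝ :=
  if h : (j + N).toNat < 2*N+2 then z ⟨(j + N).toNat, h⟩ else 0

/-- The index of `z_j` in `Fin (2N+2)`. -/
def zidx (N : ℕ) (j : ℤ) : Fin (2*N+2) := ⟨min (j+N).toNat (2*N+1), by omega⟩

/-- The lattice spacings `r_j = (z_{j+1} - z_j)/ν_j`. -/
def rzp (N : ℕ) (ν : ℤ → ℕ) (z : Fin (2*N+2) → ℝ) (j : ℤ) : ℝ :=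
  (czp N z (j+1) - czp N z j) / (ν j : ℝ)

/-- The force-based quasicontinuum forces as functions of the positions `z`. -/
def FQCFz (N K : ℕ) (η : ℝ → ℝ) (ν : ℤ → ℕ) (z : Fin (2*N+2) → ℝ) (j : ℤ) : ℝ :=
  FQCFr N K η (rzp N ν z) j

theorem czp_eq_apply_zidx {N : ℕ} (z : Fin (2*N+2) → ℝ) {j : ℤ} (hj : -(N:ℤ) ≤ j)
    (hj' : j ≤ (N:ℤ)+1) : czp N z j = z (zidx N j) := by
  have h : (j + N).toNat < 2*N+2 := by omega
  rw [czp, dif_pos h]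
  congr 1
  ext
  simp only [zidx]
  omega

theorem zidx_ne {N : ℕ} {i j : ℤ} (hi : -(N:ℤ) ≤ i) (hi' : i ≤ (N:ℤ)+1) (hj : -(N:ℤ) ≤ j)
    (hj' : j ≤ (N:ℤ)+1) (hij : i ≠ j) : zidx N i ≠ zidx N j := by
  intro h
  simp only [zidx, Fin.mk.injEq] at h
  omega

theorem rzp_eq_sub {N : ℕ} {ν : ℤ → ℕ} (z : Fin (2*N+2) → ℝ) {j : ℤ} (hj : -(N:ℤ) ≤ j)
    (hj' : j ≤ (N:ℤ)) (hν : ν j = 1) : rzp N ν z j = z (zidx N (j+1)) - z (zidx N j) := by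
  rw [rzp, hν, czp_eq_apply_zidx z (by omega) (by omega), czp_eq_apply_zidx z hj (by omega)]
  simp

/-- The force on the last atom treated atomistically, on a unit mesh near the interface. -/
theorem FQCFz_interface_atomistic {N K : ℕ} (hK : 2 ≤ K) (hKN : K + 2 ≤ N) (η : ℝ → ℝ)
    {ν : ℤ → ℕ} (hν : ∀ j : ℤ, -(K:ℤ)-1 ≤ j → j ≤ (K:ℤ)+1 → ν j = 1) (z : Fin (2*N+2) → ℝ) :
    FQCFz N K η ν z K =
      (η (z (zidx N (K+1)) - z (zidx N K)) + η (z (zidx N (K+2)) - z (zidx N K)))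
        - (η (z (zidx N K) - z (zidx N (K-1))) + η (z (zidx N K) - z (zidx N (K-2)))) := by
  rw [FQCFz, FQCFr, if_neg (by omega), if_neg (by omega), if_pos (by omega),
    rzp_eq_sub z (by omega) (by omega) (hν K (by omega) (by omega)),
    rzp_eq_sub z (by omega) (by omega) (hν (K+1) (by omega) (by omega)),
    rzp_eq_sub z (by omega) (by omega) (hν (K-1) (by omega) (by omega)),
    rzp_eq_sub z (by omega) (by omega) (hν (K-2) (by omega) (by omega)),
    show (K:ℤ)+1+1 = K+2 by ring, show (K:ℤ)-1+1 = K by ring, show (K:ℤ)-2+1 = K-1 by ring,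
    add_comm (z (zidx N (K+1)) - z (zidx N K)), sub_add_sub_cancel, sub_add_sub_cancel]

/-- The force on the first atom treated by the continuum model, on a unit mesh near the
interface. -/
theorem FQCFz_interface_continuum {N K : ℕ} (hKN : K + 2 ≤ N) (η : ℝ → ℝ)
    {ν : ℤ → ℕ} (hν : ∀ j : ℤ, -(K:ℤ)-1 ≤ j → j ≤ (K:ℤ)+1 → ν j = 1) (z : Fin (2*N+2) → ℝ) :
    FQCFz N K η ν z (K+1) =
      etaHat η (z (zidx N (K+2)) - z (zidx N (K+1)))
        - etaHat η (z (zidx N (K+1)) - z (zidx N K)) := by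
  rw [FQCFz, FQCFr, if_neg (by omega), if_neg (by omega), if_neg (by omega),
    show (K:ℤ)+1-1 = K by ring,
    rzp_eq_sub z (by omega) (by omega) (hν K (by omega) (by omega)),
    rzp_eq_sub z (by omega) (by omega) (hν (K+1) (by omega) (by omega)),
    show (K:ℤ)+1+1 = K+2 by ring, etaHat, etaHat]

theorem hasDerivAt_FQCFz_interface_atomistic {N K : ℕ} (hK : 2 ≤ K) (hKN : K + 2 ≤ N)
    {η : ℝ → ℝ} {ν : ℤ → ℕ} (hν : ∀ j : ℤ, -(K:ℤ)-1 ≤ j → j ≤ (K:ℤ)+1 → ν j = 1)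
    (z : Fin (2*N+2) → ℝ)
    (hη : DifferentiableAt ℝ η (z (zidx N (K+1)) - z (zidx N K))) :
    HasDerivAt (fun t => FQCFz N K η ν (Function.update z (zidx N ((K:ℤ)+1)) t) (K:ℤ))
      (deriv η (z (zidx N (K+1)) - z (zidx N K))) (z (zidx N ((K:ℤ)+1))) := by
  have h0 : zidx N K ≠ zidx N (K+1) :=
    zidx_ne (by omega) (by omega) (by omega) (by omega) (by omega)
  have h1 : zidx N (K+2) ≠ zidx N (K+1) :=
    zidx_ne (by omega) (by omega) (by omega) (by omega) (by omega)
  have h2 : zidx N (K-1) ≠ zidx N (K+1) :=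
    zidx_ne (by omega) (by omega) (by omega) (by omega) (by omega)
  have h3 : zidx N (K-2) ≠ zidx N (K+1) :=
    zidx_ne (by omega) (by omega) (by omega) (by omega) (by omega)
  simp only [FQCFz_interface_atomistic hK hKN η hν, Function.update_self,
    Function.update_of_ne h0, Function.update_of_ne h1, Function.update_of_ne h2,
    Function.update_of_ne h3]
  exact ((hη.hasDerivAt.comp_sub_const _ _).add_const _).sub_const _

theorem hasDerivAt_FQCFz_interface_continuum {N K : ℕ} (hKN : K + 2 ≤ N)
    {η : ℝ → ℝ} {ν : ℤ → ℕ} (hν : ∀ j : ℤ, -(K:ℤ)-1 ≤ j → j ≤ (K:ℤ)+1 → ν j = 1)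
    (z : Fin (2*N+2) → ℝ)
    (hη : DifferentiableAt ℝ η (z (zidx N (K+1)) - z (zidx N K)))
    (hη' : DifferentiableAt ℝ η (2 * (z (zidx N (K+1)) - z (zidx N K)))) :
    HasDerivAt (fun t => FQCFz N K η ν (Function.update z (zidx N (K:ℤ)) t) ((K:ℤ)+1))
      (deriv η (z (zidx N (K+1)) - z (zidx N K))
        + 4 * deriv η (2 * (z (zidx N (K+1)) - z (zidx N K)))) (z (zidx N (K:ℤ))) := by
  have h1 : zidx N (K+1) ≠ zidx N K :=
    zidx_ne (by omega) (by omega) (by omega) (by omega) (by omega)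
  have h2 : zidx N (K+2) ≠ zidx N K :=
    zidx_ne (by omega) (by omega) (by omega) (by omega) (by omega)
  simp only [FQCFz_interface_continuum hKN η hν, Function.update_self,
    Function.update_of_ne h1, Function.update_of_ne h2, etaHat]
  have hsub : HasDerivAt (fun t => z (zidx N (K+1)) - t) (-1) (z (zidx N K)) :=
    (hasDerivAt_id _).const_sub _
  have hone := HasDerivAt.comp (z (zidx N K)) hη.hasDerivAt hsub
  have htwo := HasDerivAt.comp (z (zidx N K)) hη'.hasDerivAt (hsub.const_mul 2)
  exact ((hone.add (htwo.const_mul 2)).const_sub _).congr_deriv (by ring)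

section MixedPartials

variable {ι : Type*} [Fintype ι] [DecidableEq ι]

theorem deriv_comp_update {F : Type*} [NormedAddCommGroup F] [NormedSpace ℝ F]
    {f : (ι → ℝ) → F} {x : ι → ℝ} (hf : DifferentiableAt ℝ f x) (i : ι) :
    deriv (fun t => f (Function.update x i t)) (x i) = fderiv ℝ f x (Pi.single i 1) := by
  have hf' : HasFDerivAt f (fderiv ℝ f x) (Function.update x i (x i)) := by
    rw [Function.update_eq_self]
    exact hf.hasFDerivAt
  exact (hf'.comp_hasDerivAt (x i) (hasDerivAt_update x i (x i))).deriv

theorem deriv_deriv_update_eq_fderiv_fderiv {E : (ι → ℝ) → ℝ} {w : ι → ℝ}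
    (hE : ContDiffAt ℝ 2 E w) (i j : ι) :
    deriv (fun t => deriv (fun s => E (Function.update (Function.update w i t) j s))
        (Function.update w i t j)) (w i) =
      fderiv ℝ (fderiv ℝ E) w (Pi.single i 1) (Pi.single j 1) := by
  have hev : ∀ᶠ t in nhds (w i), ContDiffAt ℝ 2 E (Function.update w i t) := by
    apply (hasDerivAt_update w i (w i)).continuousAt.eventually
    rw [Function.update_eq_self]
    exact hE.eventually (by simp)
  have hd : DifferentiableAt ℝ (fderiv ℝ E) w :=
    (hE.fderiv_right (m := 1) (by norm_num)).differentiableAt (by norm_num)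
  have heq : (fun t => deriv (fun s => E (Function.update (Function.update w i t) j s))
      (Function.update w i t j)) =ᶠ[nhds (w i)]
      fun t => fderiv ℝ E (Function.update w i t) (Pi.single j 1) := by
    filter_upwards [hev] with t ht
    exact deriv_comp_update (ht.differentiableAt (by norm_num)) j
  rw [heq.deriv_eq, deriv_comp_update (f := fun x => fderiv ℝ E x (Pi.single j 1))
    (hd.clm_apply (differentiableAt_const _)), fderiv_clm_apply hd (differentiableAt_const _)]
  simp

theorem deriv_deriv_update_comm {E : (ι → ℝ) → ℝ} {w : ι → ℝ}
    (hE : ContDiffAt ℝ 2 E w) (i j : ι) :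
    deriv (fun t => deriv (fun s => E (Function.update (Function.update w i t) j s))
        (Function.update w i t j)) (w i) =
      deriv (fun t => deriv (fun s => E (Function.update (Function.update w j t) i s))
        (Function.update w j t i)) (w j) := by
  rw [deriv_deriv_update_eq_fderiv_fderiv hE, deriv_deriv_update_eq_fderiv_fderiv hE]
  exact (hE.isSymmSndFDerivAt (by simp)).eq _ _

/-- A field which is minus the gradient of a `C²` function on an open set has a symmetric
Jacobian there. -/
theorem deriv_update_comm_of_eq_neg_gradient {U : Set (ι → ℝ)} (hU : IsOpen U)
    {E : (ι → ℝ) → ℝ} (hE : ContDiffOn ℝ 2 E U) {i j : ι} {f g : (ι → ℝ) → ℝ}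
    (hf : ∀ w ∈ U, f w = -deriv (fun t => E (Function.update w i t)) (w i))
    (hg : ∀ w ∈ U, g w = -deriv (fun t => E (Function.update w j t)) (w j))
    {w : ι → ℝ} (hw : w ∈ U) :
    deriv (fun t => f (Function.update w j t)) (w j) =
      deriv (fun t => g (Function.update w i t)) (w i) := by
  have hev : ∀ k : ι, ∀ᶠ t in nhds (w k), Function.update w k t ∈ U := fun k => by
    apply (hasDerivAt_update w k (w k)).continuousAt.eventually
    rw [Function.update_eq_self]
    exact hU.mem_nhds hw
  rw [Filter.EventuallyEq.deriv_eq ((hev j).mono fun t ht => hf _ ht),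
    Filter.EventuallyEq.deriv_eq ((hev i).mono fun t ht => hg _ ht),
    deriv.fun_neg, deriv.fun_neg,
    deriv_deriv_update_comm (hE.contDiffAt (hU.mem_nhds hw))]

end MixedPartials

/-- The force-based quasicontinuum forces are nonconservative: the mixed partial derivatives
`∂F^{QCF}_K/∂z_{K+1} = η'(r_K)` and `∂F^{QCF}_{K+1}/∂z_K = η'(r_K) + 4η'(2r_K)` differ whenever
`η'(2(z_{K+1}-z_K)) ≠ 0`, so the Jacobian of the force field is not symmetric there, and on any
open set of increasing configurations where `η'(2(z_{K+1}-z_K)) ≠ 0` there is no `C²` energy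
`E` with `F^{QCF}_j = -∂E/∂z_j` for all `j`. -/
theorem forces_nonconservative
    (N K : ℕ) (hK : 2 ≤ K) (hKN : K + 2 ≤ N)
    (φ η : ℝ → ℝ) (hφ : ContDiffOn ℝ 3 φ (Set.Ioi 0)) (hη : η = deriv φ)
    (ν : ℤ → ℕ) (hν : ∀ j, 0 < ν j)
    (hν1 : ∀ j : ℤ, -(K:ℤ)-1 ≤ j → j ≤ (K:ℤ)+1 → ν j = 1)
    (z : Fin (2*N+2) → ℝ)
    (hz : ∀ j : ℤ, -(N:ℤ) ≤ j → j ≤ (N:ℤ) → czp N z j < czp N z (j+1)) :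
    deriv (fun t => FQCFz N K η ν (Function.update z (zidx N ((K:ℤ)+1)) t) (K:ℤ))
        (z (zidx N ((K:ℤ)+1))) = deriv η (rzp N ν z (K:ℤ)) ∧
    deriv (fun t => FQCFz N K η ν (Function.update z (zidx N (K:ℤ)) t) ((K:ℤ)+1))
        (z (zidx N (K:ℤ))) =
      deriv η (rzp N ν z (K:ℤ)) + 4 * deriv η (2 * rzp N ν z (K:ℤ)) ∧
    (deriv η (2 * (czp N z ((K:ℤ)+1) - czp N z (K:ℤ))) ≠ 0 →
      deriv (fun t => FQCFz N K η ν (Function.update z (zidx N ((K:ℤ)+1)) t) (K:ℤ))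
          (z (zidx N ((K:ℤ)+1))) ≠
      deriv (fun t => FQCFz N K η ν (Function.update z (zidx N (K:ℤ)) t) ((K:ℤ)+1))
          (z (zidx N (K:ℤ)))) ∧
    (∀ U : Set (Fin (2*N+2) → ℝ), IsOpen U → U.Nonempty →
      (∀ w ∈ U, (∀ j : ℤ, -(N:ℤ) ≤ j → j ≤ (N:ℤ) → czp N w j < czp N w (j+1)) ∧
        deriv η (2 * (czp N w ((K:ℤ)+1) - czp N w (K:ℤ))) ≠ 0) →
      ¬ ∃ E : (Fin (2*N+2) → ℝ) → ℝ, ContDiffOn ℝ 2 E U ∧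
        ∀ w ∈ U, ∀ j : ℤ, -(N:ℤ) ≤ j → j ≤ (N:ℤ)+1 →
          FQCFz N K η ν w j =
            - deriv (fun t => E (Function.update w (zidx N j) t)) (w (zidx N j))) := by
  have hdiff : ∀ x : ℝ, 0 < x → DifferentiableAt ℝ η x := fun x hx => by
    rw [hη]
    exact ((hφ.deriv_of_isOpen (m := 1) isOpen_Ioi (by norm_num)).contDiffAt
      (Ioi_mem_nhds hx)).differentiableAt (by norm_num)
  have hpos : ∀ w : Fin (2*N+2) → ℝ,
      (∀ j : ℤ, -(N:ℤ) ≤ j → j ≤ (N:ℤ) → czp N w j < czp N w (j+1)) →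
      0 < w (zidx N (K+1)) - w (zidx N K) := fun w hw => by
    have h := hw K (by omega) (by omega)
    rwa [czp_eq_apply_zidx w (by omega) (by omega), czp_eq_apply_zidx w (by omega) (by omega),
      ← sub_pos] at h
  have hleft := fun w hw => (hasDerivAt_FQCFz_interface_atomistic hK hKN hν1 w
    (hdiff _ (hpos w hw))).deriv
  have hright := fun w hw => (hasDerivAt_FQCFz_interface_continuum hKN hν1 w
    (hdiff _ (hpos w hw)) (hdiff _ (mul_pos two_pos (hpos w hw)))).deriv
  have hne : ∀ w : Fin (2*N+2) → ℝ,
      (∀ j : ℤ, -(N:ℤ) ≤ j → j ≤ (N:ℤ) → czp N w j < czp N w (j+1)) →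
      deriv η (2 * (czp N w ((K:ℤ)+1) - czp N w (K:ℤ))) ≠ 0 →
      deriv (fun t => FQCFz N K η ν (Function.update w (zidx N ((K:ℤ)+1)) t) (K:ℤ))
          (w (zidx N ((K:ℤ)+1))) ≠
      deriv (fun t => FQCFz N K η ν (Function.update w (zidx N (K:ℤ)) t) ((K:ℤ)+1))
          (w (zidx N (K:ℤ))) := fun w hw h0 h => by
    rw [hleft w hw, hright w hw] at h
    rw [czp_eq_apply_zidx w (by omega) (by omega),
      czp_eq_apply_zidx w (by omega) (by omega)] at h0
    apply h0
    linarith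
  have hr := rzp_eq_sub z (j := K) (by omega) (by omega) (hν1 K (by omega) (by omega))
  refine ⟨?_, ?_, hne z hz, ?_⟩
  · rw [hr, hleft z hz]
  · rw [hr, hright z hz]
  · rintro U hU ⟨w, hw⟩ hUw ⟨E, hE, hforce⟩
    exact hne w (hUw w hw).1 (hUw w hw).2 (deriv_update_comm_of_eq_neg_gradient hU hE
      (fun x hx => hforce x hx K (by omega) (by omega))
      (fun x hx => hforce x hx (K+1) (by omega) (by omega)) hw)
end
end

section
/- Let M, N be positive integers and let −M = ℓ_{−N} < ℓ_{−N+1} < ⋯ < ℓ_{N+1} = M+1 be integers; set ν_j = ℓ_{j+1} − ℓ_j. Let z_{−N} < z_{−N+1} < ⋯ < z_{N+1} be reals, set r_j = (z_{j+1} − z_j)/ν_j, and define atom positions y_{−M},…,y_{M+1} by linear interpolation: y_{ℓ_j + i} = ((ν_j − i)/ν_j) z_j + (i/ν_j) z_{j+1} for 0 ≤ i ≤ ν_j and −N ≤ j ≤ N. Then the total atomistic energy with nearest- and next-nearest-neighbor interactions satisfies Σ_{i=−M}^{M} φ(y_{i+1} − y_i) + Σ_{i=−M+1}^{M} φ(y_{i+1}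 − y_{i−1}) = Σ_{j=−N}^{N} ν_j φ̂(r_j) + S_{−N} + Σ_{j=−N+1}^{N} S_j + S_{N+1}, where φ̂(r) = φ(r) + φ(2r), S_{−N} = −(1/2)φ(2r_{−N}), S_j = −(1/2)φ(2r_{j−1}) + φ(r_{j−1} + r_j) − (1/2)φ(2r_j) for −N+1 ≤ j ≤ N, and S_{N+1} = −(1/2)φ(2r_N). -/
open Finset

noncomputable section

/-- The lattice spacing `r_j = (z_{j+1} - z_j)/ν_j` with `ν_j = ℓ_{j+1} - ℓ_j`. -/
def rquot (ℓ : ℤ → ℤ) (z : ℤ → ℝ) (j : ℤ) : ℝ :=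
  (z (j+1) - z j) / ((ℓ (j+1) - ℓ j : ℤ) : ℝ)

/-- Linear interpolation on the block `[ℓ j, ℓ (j+1)]` makes consecutive atoms equally spaced. -/
lemma interpolation_spacing (ℓ : ℤ → ℤ) (z y : ℤ → ℝ) (j : ℤ)
    (hy : ∀ i : ℤ, 0 ≤ i → i ≤ ℓ (j+1) - ℓ j →
      y (ℓ j + i) = (((ℓ (j+1) - ℓ j - i : ℤ) : ℝ) / ((ℓ (j+1) - ℓ j : ℤ) : ℝ)) * z j +
                    ((i : ℝ) / ((ℓ (j+1) - ℓ j : ℤ) : ℝ)) * z (j+1))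
    (i : ℤ) (hi : ℓ j ≤ i) (hi' : i < ℓ (j+1)) :
    y (i+1) - y i = rquot ℓ z j := by
  have h₀ := hy (i - ℓ j) (by omega) (by omega)
  have h₁ := hy (i + 1 - ℓ j) (by omega) (by omega)
  rw [add_sub_cancel] at h₀ h₁
  rw [h₀, h₁, rquot]
  push_cast
  ring

lemma sum_int_Ico_consecutive (f : ℤ → ℝ) {a b c : ℤ} (hab : a ≤ b) (hbc : b ≤ c) :
    ∑ i ∈ Finset.Ico a b, f i + ∑ i ∈ Finset.Ico b c, f i = ∑ i ∈ Finset.Ico a c, f i := by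
  rw [← Finset.sum_union (Finset.Ico_disjoint_Ico_consecutive a b c),
    Finset.Ico_union_Ico_eq_Ico hab hbc]

/-- Energy decomposition for the chain formed by the blocks `a, …, k`, given constant spacing
`r j` on the block `j`. -/
lemma block_energy_decomposition (φ : ℝ → ℝ) (ℓ : ℤ → ℤ) (y r : ℤ → ℝ) (a b : ℤ)
    (hmono : ∀ j : ℤ, a ≤ j → j ≤ b → ℓ j < ℓ (j+1))
    (hr : ∀ j : ℤ, a ≤ j → j ≤ b → ∀ i : ℤ, ℓ j ≤ i → i < ℓ (j+1) → y (i+1) - y i = r j)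
    (k : ℤ) (hak : a ≤ k) (hkb : k ≤ b) :
    (∑ i ∈ Finset.Ico (ℓ a) (ℓ (k+1)), φ (y (i+1) - y i)) +
      (∑ i ∈ Finset.Ico (ℓ a + 1) (ℓ (k+1)), φ (y (i+1) - y (i-1))) =
    (∑ j ∈ Finset.Ico a (k+1), ((ℓ (j+1) - ℓ j : ℤ) : ℝ) * (φ (r j) + φ (2 * r j)))
      + (-(1/2) * φ (2 * r a))
      + (∑ j ∈ Finset.Ico (a+1) (k+1),
          (-(1/2) * φ (2 * r (j-1)) + φ (r (j-1) + r j) - (1/2) * φ (2 * r j)))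
      + (-(1/2) * φ (2 * r k)) := by
  have nearest (j : ℤ) (h₁ : a ≤ j) (h₂ : j ≤ b) :
      ∑ i ∈ Finset.Ico (ℓ j) (ℓ (j+1)), φ (y (i+1) - y i) =
        ((ℓ (j+1) - ℓ j : ℤ) : ℝ) * φ (r j) := by
    have hj := hmono j h₁ h₂
    rw [Finset.sum_congr rfl fun i hi => by
      rw [hr j h₁ h₂ i (Finset.mem_Ico.1 hi).1 (Finset.mem_Ico.1 hi).2]]
    rw [Finset.sum_const, Int.card_Ico, nsmul_eq_mul, ← Int.cast_natCast,
      Int.toNat_of_nonneg (by omega)]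
  have next_nearest (j : ℤ) (h₁ : a ≤ j) (h₂ : j ≤ b) :
      ∑ i ∈ Finset.Ico (ℓ j + 1) (ℓ (j+1)), φ (y (i+1) - y (i-1)) =
        (((ℓ (j+1) - ℓ j : ℤ) : ℝ) - 1) * φ (2 * r j) := by
    have hj := hmono j h₁ h₂
    have hstep (i : ℤ) (hi : i ∈ Finset.Ico (ℓ j + 1) (ℓ (j+1))) :
        φ (y (i+1) - y (i-1)) = φ (2 * r j) := by
      rw [Finset.mem_Ico] at hi
      have e₁ := hr j h₁ h₂ i (by omega) hi.2
      have e₂ := hr j h₁ h₂ (i-1) (by omega) (by omega)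
      rw [sub_add_cancel] at e₂
      congr 1
      linarith
    rw [Finset.sum_congr rfl hstep, Finset.sum_const, Int.card_Ico, nsmul_eq_mul,
      ← Int.cast_natCast, Int.toNat_of_nonneg (by omega)]
    push_cast
    ring
  have hle (k : ℤ) (hak : a ≤ k) : k ≤ b → ℓ a < ℓ (k+1) := by
    induction k, hak using Int.leInduction with
    | base => exact hmono a le_rfl
    | succ k hk ih =>
      intro hkb
      exact (ih (by omega)).trans (hmono (k+1) (by omega) hkb)
  induction k, hak using Int.leInduction with
  | base =>
    rw [nearest a le_rfl hkb, next_nearest a le_rfl hkb, Finset.Ico_self, Finset.sum_empty,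
      ← Finset.insert_Ico_add_one_left_eq_Ico (lt_add_one a), Finset.Ico_self]
    simp only [insert_empty_eq, Finset.sum_singleton]
    ring
  | succ k hk ih =>
    have ih := ih (by omega)
    have hlk := hle k hk (by omega)
    have hlk' := hmono (k+1) (by omega) hkb
    have hlk₀ := hmono k hk (by omega)
    have hinterface : y (ℓ (k+1) + 1) - y (ℓ (k+1) - 1) = r k + r (k+1) := by
      have e₁ := hr (k+1) (by omega) hkb (ℓ (k+1)) le_rfl hlk'
      have e₂ := hr k hk (by omega) (ℓ (k+1) - 1) (by omega) (by omega)
      rw [sub_add_cancel] at e₂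
      linarith
    rw [← sum_int_Ico_consecutive _ hlk.le hlk'.le,
      ← sum_int_Ico_consecutive _ (Int.add_one_le_iff.2 hlk) hlk'.le,
      nearest (k+1) (by omega) hkb, ← Finset.insert_Ico_add_one_left_eq_Ico hlk',
      Finset.sum_insert (by simp), next_nearest (k+1) (by omega) hkb, hinterface,
      ← Finset.insert_Ico_right_eq_Ico_add_one (show a ≤ k + 1 by omega),
      ← Finset.insert_Ico_right_eq_Ico_add_one (show a + 1 ≤ k + 1 by omega),
      Finset.sum_insert (by simp), Finset.sum_insert (by simp), add_sub_cancel_right]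
    linarith

/-- Decomposition of the constrained atomistic quasicontinuum energy into local energy
densities plus surface/interfacial terms. -/
theorem constrained_energy_decomposition
    (M N : ℕ) (hM : 1 ≤ M) (hN : 1 ≤ N)
    (φ : ℝ → ℝ) (ℓ : ℤ → ℤ)
    (hl1 : ℓ (-(N:ℤ)) = -(M:ℤ)) (hl2 : ℓ ((N:ℤ)+1) = (M:ℤ)+1)
    (hmono : ∀ j : ℤ, -(N:ℤ) ≤ j → j ≤ (N:ℤ) → ℓ j < ℓ (j+1))
    (z y : ℤ → ℝ)
    (hz : ∀ j : ℤ, -(N:ℤ) ≤ j → j ≤ (N:ℤ) → z j < z (j+1))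
    (hy : ∀ j : ℤ, -(N:ℤ) ≤ j → j ≤ (N:ℤ) → ∀ i : ℤ, 0 ≤ i → i ≤ ℓ (j+1) - ℓ j →
      y (ℓ j + i) = (((ℓ (j+1) - ℓ j - i : ℤ) : ℝ) / ((ℓ (j+1) - ℓ j : ℤ) : ℝ)) * z j +
                    ((i : ℝ) / ((ℓ (j+1) - ℓ j : ℤ) : ℝ)) * z (j+1)) :
    (∑ i ∈ Finset.Icc (-(M:ℤ)) (M:ℤ), φ (y (i+1) - y i)) +
      (∑ i ∈ Finset.Icc (-(M:ℤ)+1) (M:ℤ), φ (y (i+1) - y (i-1))) =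
    (∑ j ∈ Finset.Icc (-(N:ℤ)) (N:ℤ),
        ((ℓ (j+1) - ℓ j : ℤ) : ℝ) * (φ (rquot ℓ z j) + φ (2 * rquot ℓ z j)))
      + (-(1/2) * φ (2 * rquot ℓ z (-(N:ℤ))))
      + (∑ j ∈ Finset.Icc (-(N:ℤ)+1) (N:ℤ),
          (-(1/2) * φ (2 * rquot ℓ z (j-1)) + φ (rquot ℓ z (j-1) + rquot ℓ z j)
            - (1/2) * φ (2 * rquot ℓ z j)))
      + (-(1/2) * φ (2 * rquot ℓ z (N:ℤ))) := by
  have h := block_energy_decomposition φ ℓ y (rquot ℓ z) (-(N:ℤ)) N hmono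
    (fun j h₁ h₂ => interpolation_spacing ℓ z y j (hy j h₁ h₂)) N (by omega) le_rfl
  rw [hl1, hl2] at h
  simpa only [Finset.Ico_add_one_right_eq_Icc] using h
end
end

section
/- For every r ∈ (0,∞)^{2N+1}, the partial sums ψ^F_j(r) = Σ_{i=−N}^{j} F^{QCF}_i(r) have the closed form: ψ^F_j(r) = η(r_j) + 2η(2r_j) for −N ≤ j ≤ −K; ψ^F_j(r) = η(r_j) + η(r_j + r_{j−1}) + η(r_j + r_{j+1}) + G_{−K}(r) for −K+1 ≤ j ≤ K; ψ^F_j(r) = η(r_j) + 2η(2r_j) + G_{−K}(r) − G_{K}(r) for K+1 ≤ j ≤ N; and ψ^F_{N+1}(r) = G_{−K}(r) − G_{K}(r); where G_k(r) = 2η(2r_k) − η(r_k + r_{k−1}) − η(r_k + r_{k+1}) for k = K and k = −K. -/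
open Finset Set

noncomputable section

/-- The nonlocal interfacial term `G_k(r) = 2η(2r_k) - η(r_k + r_{k-1}) - η(r_k + r_{k+1})`. -/
def Gterm (η : ℝ → ℝ) (r : ℤ → ℝ) (k : ℤ) : ℝ :=
  2*η (2*r k) - η (r k + r (k-1)) - η (r k + r (k+1))

/-- A sum over an integer interval splits off its last term. -/
theorem sum_Icc_int_eq_sum_sub_one_add (f : ℤ → ℝ) {a b : ℤ} (hab : a ≤ b) :
    ∑ i ∈ Finset.Icc a b, f i = ∑ i ∈ Finset.Icc a (b - 1), f i + f b := by
  have h : Finset.Icc a b = insert b (Finset.Icc a (b - 1)) := by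
    ext x
    simp only [Finset.mem_insert, Finset.mem_Icc]
    omega
  rw [h, Finset.sum_insert (by simp), add_comm]

/-- Closed form of the internal conjugate forces `ψ^F_j(r) = Σ_{i=-N}^{j} F^{QCF}_i(r)`. -/
theorem conjugate_force_closed_form
    (N K : ℕ) (hK : 2 ≤ K) (hKN : K + 2 ≤ N)
    (φ η : ℝ → ℝ) (hφ : ContDiffOn ℝ 3 φ (Set.Ioi 0)) (hη : η = deriv φ)
    (r : ℤ → ℝ) (hr : ∀ j : ℤ, -(N:ℤ) ≤ j → j ≤ (N:ℤ) → 0 < r j) :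
    (∀ j : ℤ, -(N:ℤ) ≤ j → j ≤ -(K:ℤ) →
      ∑ i ∈ Finset.Icc (-(N:ℤ)) j, FQCFr N K η r i = η (r j) + 2*η (2*r j)) ∧
    (∀ j : ℤ, -(K:ℤ)+1 ≤ j → j ≤ (K:ℤ) →
      ∑ i ∈ Finset.Icc (-(N:ℤ)) j, FQCFr N K η r i =
        η (r j) + η (r j + r (j-1)) + η (r j + r (j+1)) + Gterm η r (-(K:ℤ))) ∧
    (∀ j : ℤ, (K:ℤ)+1 ≤ j → j ≤ (N:ℤ) →
      ∑ i ∈ Finset.Icc (-(N:ℤ)) j, FQCFr N K η r i =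
        η (r j) + 2*η (2*r j) + Gterm η r (-(K:ℤ)) - Gterm η r (K:ℤ)) ∧
    (∑ i ∈ Finset.Icc (-(N:ℤ)) ((N:ℤ)+1), FQCFr N K η r i =
      Gterm η r (-(K:ℤ)) - Gterm η r (K:ℤ)) := by
  have left_continuum : ∀ j : ℤ, -(N:ℤ) ≤ j → j ≤ -(K:ℤ) →
      ∑ i ∈ Finset.Icc (-(N:ℤ)) j, FQCFr N K η r i = η (r j) + 2*η (2*r j) := by
    intro j hj
    induction j, hj using Int.leInduction with
    | base => simp [FQCFr]
    | succ j hj ih =>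
      intro hjK
      rw [sum_Icc_int_eq_sum_sub_one_add _ (by omega), add_sub_cancel_right, ih (by omega),
        FQCFr, if_neg (by omega), if_neg (by omega), if_neg (by omega), add_sub_cancel_right]
      ring
  have atomistic : ∀ j : ℤ, -(K:ℤ)+1 ≤ j → j ≤ (K:ℤ) →
      ∑ i ∈ Finset.Icc (-(N:ℤ)) j, FQCFr N K η r i =
        η (r j) + η (r j + r (j-1)) + η (r j + r (j+1)) + Gterm η r (-(K:ℤ)) := by
    intro j hj
    induction j, hj using Int.leInduction with
    | base =>
      intro _
      rw [sum_Icc_int_eq_sum_sub_one_add _ (by omega), add_sub_cancel_right,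
        left_continuum _ (by omega) le_rfl,
        FQCFr, if_neg (by omega), if_neg (by omega), if_pos (by omega), add_sub_cancel_right,
        show -(K:ℤ) + 1 - 2 = -(K:ℤ) - 1 by ring, Gterm,
        add_comm (r (-(K:ℤ) + 1)) (r (-(K:ℤ)))]
      ring
    | succ j hj ih =>
      intro hjK
      rw [sum_Icc_int_eq_sum_sub_one_add _ (by omega), add_sub_cancel_right, ih (by omega),
        FQCFr, if_neg (by omega), if_neg (by omega), if_pos (by omega), add_sub_cancel_right,
        show j + 1 - 2 = j - 1 by ring, add_comm (r (j + 1)) (r j)]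
      ring
  have right_continuum : ∀ j : ℤ, (K:ℤ)+1 ≤ j → j ≤ (N:ℤ) →
      ∑ i ∈ Finset.Icc (-(N:ℤ)) j, FQCFr N K η r i =
        η (r j) + 2*η (2*r j) + Gterm η r (-(K:ℤ)) - Gterm η r (K:ℤ) := by
    intro j hj
    induction j, hj using Int.leInduction with
    | base =>
      intro _
      rw [sum_Icc_int_eq_sum_sub_one_add _ (by omega), add_sub_cancel_right,
        atomistic _ (by omega) le_rfl,
        FQCFr, if_neg (by omega), if_neg (by omega), if_neg (by omega), add_sub_cancel_right,
        Gterm.eq_def η r (K:ℤ)]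
      ring
    | succ j hj ih =>
      intro hjN
      rw [sum_Icc_int_eq_sum_sub_one_add _ (by omega), add_sub_cancel_right, ih (by omega),
        FQCFr, if_neg (by omega), if_neg (by omega), if_neg (by omega), add_sub_cancel_right]
      ring
  refine ⟨left_continuum, atomistic, right_continuum, ?_⟩
  rw [sum_Icc_int_eq_sum_sub_one_add _ (by omega), add_sub_cancel_right,
    right_continuum _ (by omega) le_rfl, FQCFr, if_neg (by omega), if_pos rfl,
    add_sub_cancel_right]
  ring
end
end

section
/- Let z be a uniform configuration with lattice spacing a > 0, i.e., z_{j+1} − z_j = ν_j a for all j = −N,…,N. Then the energy-based quasicontinuum forces F^{QCE}_j(z) = −∂E^{QC}/∂z_j satisfy: F^{QCE}_j = 0 for −N+1 ≤ j ≤ −K−2, for −K+3 ≤ j ≤ K−2, and for K+3 ≤ j ≤ N; F^{QCE}_{−N} = η(a) + 2η(2a) and F^{QCE}_{N+1} = −[η(a) + 2η(2a)]; and at the interface F^{QCE}_{−K−1} = (1/2)η(2a), F^{QCE}_{−K} = −(1/2)η(2a), F^{QCE}_{−K+1} = −(1/2)η(2a), F^{QCE}_{−K+2} = (1/2)η(2a),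 F^{QCE}_{K−1} = −(1/2)η(2a), F^{QCE}_{K} = (1/2)η(2a), F^{QCE}_{K+1} = (1/2)η(2a), F^{QCE}_{K+2} = −(1/2)η(2a). In particular, whenever η(2a) ≠ 0 the energy-based quasicontinuum approximation exhibits nonzero interfacial ('ghost') forces at a uniform configuration. -/
open Finset Set

noncomputable section

/-- The continuum (local quasicontinuum) site energy `E^L_j(z)`, with the boundary
conventions that the `r_{-N-1}` term (for `j = -N`) and the `r_{N+1}` term (for `j = N+1`)
are set to zero. -/
def ELsite (N : ℕ) (φ : ℝ → ℝ) (ν : ℤ → ℕ) (z : Fin (2*N+2) → ℝ) (j : ℤ) : ℝ :=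
  (1/2) * ((if j = (N:ℤ)+1 then 0
              else (φ (rzp N ν z j) + φ (2 * rzp N ν z j)) * (ν j : ℝ))
         + (if j = -(N:ℤ) then 0
              else (φ (rzp N ν z (j-1)) + φ (2 * rzp N ν z (j-1))) * (ν (j-1) : ℝ)))

/-- The atomistic site energy `E^a_j(z)` (valid near the interface where the mesh is unit). -/
def Easite (N : ℕ) (φ : ℝ → ℝ) (z : Fin (2*N+2) → ℝ) (j : ℤ) : ℝ :=
  (1/2) * (φ (czp N z (j+1) - czp N z j) + φ (czp N z (j+2) - czp N z j)
         + φ (czp N z j - czp N z (j-1)) + φ (czp N z j - czp N z (j-2)))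

/-- The energy-based quasicontinuum energy `E^{QC}(z)`. -/
def EQC (N K : ℕ) (φ : ℝ → ℝ) (ν : ℤ → ℕ) (z : Fin (2*N+2) → ℝ) : ℝ :=
  (∑ j ∈ Finset.Icc (-(N:ℤ)) (-(K:ℤ)), ELsite N φ ν z j)
  + (∑ j ∈ Finset.Icc (-(K:ℤ)+1) (K:ℤ), Easite N φ z j)
  + (∑ j ∈ Finset.Icc ((K:ℤ)+1) ((N:ℤ)+1), ELsite N φ ν z j)

/-- The energy-based quasicontinuum force `F^{QCE}_j(z) = -∂E^{QC}/∂z_j`. -/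
def FQCE (N K : ℕ) (φ : ℝ → ℝ) (ν : ℤ → ℕ) (z : Fin (2*N+2) → ℝ) (j : ℤ) : ℝ :=
  - deriv (fun t => EQC N K φ ν (Function.update z (zidx N j) t)) (z (zidx N j))

theorem czp_update_zidx (N : ℕ) (z : Fin (2*N+2) → ℝ) {i j : ℤ}
    (hj : -(N:ℤ) ≤ j ∧ j ≤ N + 1) (hi : -(N:ℤ) ≤ i ∧ i ≤ N + 1) (t : ℝ) :
    czp N (Function.update z (zidx N j) t) i = if i = j then t else czp N z i := by
  have hlt : (i + N).toNat < 2*N+2 := by omega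
  have hidx : (⟨(i + N).toNat, hlt⟩ : Fin (2*N+2)) = zidx N j ↔ i = j := by
    simp only [zidx, Fin.mk.injEq]
    omega
  simp only [czp, dif_pos hlt, Function.update_apply, hidx]

theorem update_zidx_self (N : ℕ) (z : Fin (2*N+2) → ℝ) (j : ℤ) :
    Function.update z (zidx N j) (z (zidx N j)) = z :=
  Function.update_eq_self _ _

/-- The derivative of the position `z_i` with respect to `z_j`. -/
def posDeriv (j i : ℤ) : ℝ := if i = j then 1 else 0

theorem hasDerivAt_czp_update (N : ℕ) (z : Fin (2*N+2) → ℝ) {i j : ℤ}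
    (hj : -(N:ℤ) ≤ j ∧ j ≤ N + 1) (hi : -(N:ℤ) ≤ i ∧ i ≤ N + 1) (x : ℝ) :
    HasDerivAt (fun t => czp N (Function.update z (zidx N j) t) i) (posDeriv j i) x := by
  simp only [czp_update_zidx N z hj hi, posDeriv]
  split_ifs
  · exact hasDerivAt_id x
  · exact hasDerivAt_const x _

theorem sum_posDeriv_add (A B j c : ℤ) :
    ∑ i ∈ Finset.Icc A B, posDeriv j (i + c) = if A ≤ j - c ∧ j - c ≤ B then 1 else 0 := by
  simp only [posDeriv, ← eq_sub_iff_add_eq, Finset.sum_ite_eq', Finset.mem_Icc]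

theorem hasDerivAt_comp_czp_sub {N : ℕ} {z : Fin (2*N+2) → ℝ} {φ : ℝ → ℝ} {j k l : ℤ} {b : ℝ}
    (hφ : DifferentiableAt ℝ φ b) (hj : -(N:ℤ) ≤ j ∧ j ≤ N + 1)
    (hk : -(N:ℤ) ≤ k ∧ k ≤ N + 1) (hl : -(N:ℤ) ≤ l ∧ l ≤ N + 1)
    (hb : czp N z k - czp N z l = b) :
    HasDerivAt (fun t => φ (czp N (Function.update z (zidx N j) t) k
        - czp N (Function.update z (zidx N j) t) l))
      (deriv φ b * (posDeriv j k - posDeriv j l)) (z (zidx N j)) := by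
  refine HasDerivAt.comp _ ?_
    ((hasDerivAt_czp_update N z hj hk _).sub (hasDerivAt_czp_update N z hj hl _))
  simpa only [Pi.sub_apply, update_zidx_self, hb] using hφ.hasDerivAt

/-- The derivative of one continuum bond energy `φ̂(r_k) ν_k`. -/
theorem hasDerivAt_continuum_bond {N : ℕ} {z : Fin (2*N+2) → ℝ} {φ : ℝ → ℝ} {ν : ℤ → ℕ}
    {j k : ℤ} {a : ℝ} (hφa : DifferentiableAt ℝ φ a) (hφ2a : DifferentiableAt ℝ φ (2 * a))
    (hj : -(N:ℤ) ≤ j ∧ j ≤ N + 1) (hk : -(N:ℤ) ≤ k ∧ k ≤ N) (hν : 0 < ν k)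
    (hz : czp N z (k+1) - czp N z k = (ν k : ℝ) * a) :
    HasDerivAt (fun t => (φ (rzp N ν (Function.update z (zidx N j) t) k)
        + φ (2 * rzp N ν (Function.update z (zidx N j) t) k)) * (ν k : ℝ))
      (etaHat (deriv φ) a * (posDeriv j (k+1) - posDeriv j k)) (z (zidx N j)) := by
  have hν0 : (ν k : ℝ) ≠ 0 := by exact_mod_cast hν.ne'
  have hr : HasDerivAt (fun t => rzp N ν (Function.update z (zidx N j) t) k)
      ((posDeriv j (k+1) - posDeriv j k) / (ν k : ℝ)) (z (zidx N j)) :=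
    ((hasDerivAt_czp_update N z hj (by omega) _).sub
      (hasDerivAt_czp_update N z hj (by omega) _)).div_const _
  have hval : rzp N ν (Function.update z (zidx N j) (z (zidx N j))) k = a := by
    rw [update_zidx_self, rzp, hz, mul_div_cancel_left₀ _ hν0]
  have h₁ := HasDerivAt.comp (h₂ := φ) (h₂' := deriv φ a) _
    (by rw [hval]; exact hφa.hasDerivAt) hr
  have h₂ := HasDerivAt.comp (h₂ := φ) (h₂' := deriv φ (2 * a)) _
    (by rw [hval]; exact hφ2a.hasDerivAt) (hr.const_mul 2)
  refine ((h₁.add h₂).mul_const (ν k : ℝ)).congr_deriv ?_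
  simp only [etaHat]
  field_simp

theorem hasDerivAt_ELsite {N : ℕ} {z : Fin (2*N+2) → ℝ} {φ : ℝ → ℝ} {ν : ℤ → ℕ}
    {j i : ℤ} {a : ℝ} (hφa : DifferentiableAt ℝ φ a) (hφ2a : DifferentiableAt ℝ φ (2 * a))
    (hj : -(N:ℤ) ≤ j ∧ j ≤ N + 1) (hi : -(N:ℤ) ≤ i ∧ i ≤ N + 1) (hν : ∀ k, 0 < ν k)
    (hz : ∀ k : ℤ, -(N:ℤ) ≤ k → k ≤ (N:ℤ) → czp N z (k+1) - czp N z k = (ν k : ℝ) * a) :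
    HasDerivAt (fun t => ELsite N φ ν (Function.update z (zidx N j) t) i)
      ((1/2) * etaHat (deriv φ) a * (posDeriv j (i+1) - posDeriv j (i+(-1))
        + (if i = (N:ℤ)+1 then posDeriv j (N+1) else 0)
        - (if i = -(N:ℤ) then posDeriv j (-N) else 0))) (z (zidx N j)) := by
  have hright : HasDerivAt (fun t => if i = (N:ℤ)+1 then (0:ℝ) else
      (φ (rzp N ν (Function.update z (zidx N j) t) i)
        + φ (2 * rzp N ν (Function.update z (zidx N j) t) i)) * (ν i : ℝ))
      (if i = (N:ℤ)+1 then 0 else etaHat (deriv φ) a * (posDeriv j (i+1) - posDeriv j i))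
      (z (zidx N j)) := by
    split_ifs with h
    · exact hasDerivAt_const _ _
    · exact hasDerivAt_continuum_bond hφa hφ2a hj (by omega) (hν i)
        (hz i (by omega) (by omega))
  have hleft : HasDerivAt (fun t => if i = -(N:ℤ) then (0:ℝ) else
      (φ (rzp N ν (Function.update z (zidx N j) t) (i-1))
        + φ (2 * rzp N ν (Function.update z (zidx N j) t) (i-1))) * (ν (i-1) : ℝ))
      (if i = -(N:ℤ) then 0 else
        etaHat (deriv φ) a * (posDeriv j (i-1+1) - posDeriv j (i-1)))
      (z (zidx N j)) := by
    split_ifs with h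
    · exact hasDerivAt_const _ _
    · exact hasDerivAt_continuum_bond hφa hφ2a hj (by omega) (hν (i-1))
        (hz (i-1) (by omega) (by omega))
  refine ((hright.add hleft).const_mul (1/2 : ℝ)).congr_deriv ?_
  have houtR : posDeriv j ((N:ℤ)+1+1) = 0 := if_neg (by omega)
  have houtL : posDeriv j (-(N:ℤ)-1) = 0 := if_neg (by omega)
  rw [sub_add_cancel, ← sub_eq_add_neg]
  split_ifs with h h' h'
  · omega
  · subst h
    rw [houtR]
    ring
  · subst h'
    rw [houtL]
    ring
  · ring

theorem hasDerivAt_Easite {N : ℕ} {z : Fin (2*N+2) → ℝ} {φ : ℝ → ℝ}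
    {j i : ℤ} {a : ℝ} (hφa : DifferentiableAt ℝ φ a) (hφ2a : DifferentiableAt ℝ φ (2 * a))
    (hj : -(N:ℤ) ≤ j ∧ j ≤ N + 1) (hi : -(N:ℤ) + 2 ≤ i ∧ i + 2 ≤ N + 1)
    (hz : ∀ k : ℤ, i - 2 ≤ k → k ≤ i + 1 → czp N z (k+1) - czp N z k = a) :
    HasDerivAt (fun t => Easite N φ (Function.update z (zidx N j) t) i)
      ((1/2) * (deriv φ a * (posDeriv j (i+1) - posDeriv j (i+(-1)))
        + deriv φ (2 * a) * (posDeriv j (i+2) - posDeriv j (i+(-2))))) (z (zidx N j)) := by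
  have hz₁ := hz (i+1) (by omega) (by omega)
  have hz₀ := hz i (by omega) (by omega)
  have hzl := hz (i-1) (by omega) (by omega)
  have hzll := hz (i-2) (by omega) (by omega)
  rw [show i + 1 + 1 = i + 2 by ring] at hz₁
  rw [show i - 1 + 1 = i by ring] at hzl
  rw [show i - 2 + 1 = i - 1 by ring] at hzll
  have d₁ := hasDerivAt_comp_czp_sub (k := i+1) (l := i) hφa hj (by omega) (by omega) hz₀
  have d₂ := hasDerivAt_comp_czp_sub (k := i+2) (l := i) (z := z) hφ2a hj (by omega) (by omega)
    (by linarith)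
  have d₃ := hasDerivAt_comp_czp_sub (k := i) (l := i-1) hφa hj (by omega) (by omega) hzl
  have d₄ := hasDerivAt_comp_czp_sub (k := i) (l := i-2) (z := z) hφ2a hj (by omega) (by omega)
    (by linarith)
  refine ((((d₁.add d₂).add d₃).add d₄).const_mul (1/2 : ℝ)).congr_deriv ?_
  rw [← sub_eq_add_neg, ← sub_eq_add_neg]
  ring

/-- All forces of the energy-based quasicontinuum model at a uniform configuration. -/
theorem FQCE_uniform (N K : ℕ) (hKN : K + 3 ≤ N) {φ : ℝ → ℝ} {ν : ℤ → ℕ} (hν : ∀ j, 0 < ν j)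
    (hν1 : ∀ j : ℤ, -(K:ℤ)-1 ≤ j → j ≤ (K:ℤ)+1 → ν j = 1)
    {a : ℝ} (hφa : DifferentiableAt ℝ φ a) (hφ2a : DifferentiableAt ℝ φ (2 * a))
    {z : Fin (2*N+2) → ℝ}
    (hz : ∀ j : ℤ, -(N:ℤ) ≤ j → j ≤ (N:ℤ) → czp N z (j+1) - czp N z j = (ν j : ℝ) * a)
    {j : ℤ} (hj : -(N:ℤ) ≤ j ∧ j ≤ N + 1) :
    FQCE N K φ ν z j = -(1/2) * (etaHat (deriv φ) a *
          ((if -(N:ℤ) ≤ j - 1 ∧ j - 1 ≤ -K then 1 else 0)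
            - (if -(N:ℤ) ≤ j + 1 ∧ j + 1 ≤ -K then 1 else 0)
            + (if (K:ℤ) + 1 ≤ j - 1 ∧ j - 1 ≤ N + 1 then 1 else 0)
            - (if (K:ℤ) + 1 ≤ j + 1 ∧ j + 1 ≤ N + 1 then 1 else 0)
            + (if j = (N:ℤ) + 1 then 1 else 0) - (if j = -(N:ℤ) then 1 else 0))
        + deriv φ a * ((if -(K:ℤ) + 1 ≤ j - 1 ∧ j - 1 ≤ K then 1 else 0)
            - (if -(K:ℤ) + 1 ≤ j + 1 ∧ j + 1 ≤ K then 1 else 0))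
        + deriv φ (2 * a) * ((if -(K:ℤ) + 1 ≤ j - 2 ∧ j - 2 ≤ K then 1 else 0)
            - (if -(K:ℤ) + 1 ≤ j + 2 ∧ j + 2 ≤ K then 1 else 0))) := by
  have hA := HasDerivAt.fun_sum (u := Finset.Icc (-(N:ℤ)) (-(K:ℤ))) fun i hi =>
    hasDerivAt_ELsite (i := i) hφa hφ2a hj
      (by rw [Finset.mem_Icc] at hi; omega) hν hz
  have hC := HasDerivAt.fun_sum (u := Finset.Icc ((K:ℤ)+1) ((N:ℤ)+1)) fun i hi =>
    hasDerivAt_ELsite (i := i) hφa hφ2a hj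
      (by rw [Finset.mem_Icc] at hi; omega) hν hz
  have hB := HasDerivAt.fun_sum (u := Finset.Icc (-(K:ℤ)+1) (K:ℤ)) fun i hi =>
    hasDerivAt_Easite (i := i) (z := z) hφa hφ2a hj
      (by rw [Finset.mem_Icc] at hi; omega) fun k hk hk' => by
        rw [Finset.mem_Icc] at hi
        rw [hz k (by omega) (by omega), hν1 k (by omega) (by omega), Nat.cast_one, one_mul]
  have hE : HasDerivAt (fun t => EQC N K φ ν (Function.update z (zidx N j) t)) _ _ :=
    (hA.add hB).add hC
  rw [FQCE, hE.deriv]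
  have hR : posDeriv j ((N:ℤ)+1) = if j = (N:ℤ)+1 then 1 else 0 := by
    simp only [posDeriv, eq_comm]
  have hL : posDeriv j (-(N:ℤ)) = if j = -(N:ℤ) then 1 else 0 := by
    simp only [posDeriv, eq_comm]
  simp only [← Finset.mul_sum, Finset.sum_add_distrib, Finset.sum_sub_distrib,
    sum_posDeriv_add, Finset.sum_ite_eq', Finset.mem_Icc, sub_neg_eq_add, hR, hL]
  rw [if_neg (show ¬(-(N:ℤ) ≤ (N:ℤ)+1 ∧ (N:ℤ)+1 ≤ -(K:ℤ)) by omega),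
    if_pos (show -(N:ℤ) ≤ -(N:ℤ) ∧ -(N:ℤ) ≤ -(K:ℤ) by omega),
    if_pos (show (K:ℤ)+1 ≤ (N:ℤ)+1 ∧ (N:ℤ)+1 ≤ (N:ℤ)+1 by omega),
    if_neg (show ¬((K:ℤ)+1 ≤ -(N:ℤ) ∧ -(N:ℤ) ≤ (N:ℤ)+1) by omega)]
  ring

/-- At a uniform configuration the energy-based quasicontinuum approximation exhibits
nonphysical "ghost" forces of size `(1/2)η(2a)` near the atomistic/continuum interfaces. -/
theorem ghost_forces_at_uniform_configuration
    (N K : ℕ) (hK : 3 ≤ K) (hKN : K + 3 ≤ N)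
    (φ η : ℝ → ℝ) (hφ : ContDiffOn ℝ 3 φ (Set.Ioi 0)) (hη : η = deriv φ)
    (ν : ℤ → ℕ) (hν : ∀ j, 0 < ν j)
    (hν1 : ∀ j : ℤ, -(K:ℤ)-1 ≤ j → j ≤ (K:ℤ)+1 → ν j = 1)
    (a : ℝ) (ha : 0 < a)
    (z : Fin (2*N+2) → ℝ)
    (hz : ∀ j : ℤ, -(N:ℤ) ≤ j → j ≤ (N:ℤ) → czp N z (j+1) - czp N z j = (ν j : ℝ) * a) :
    (∀ j : ℤ, ((-(N:ℤ)+1 ≤ j ∧ j ≤ -(K:ℤ)-2) ∨ (-(K:ℤ)+3 ≤ j ∧ j ≤ (K:ℤ)-2) ∨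
        ((K:ℤ)+3 ≤ j ∧ j ≤ (N:ℤ))) → FQCE N K φ ν z j = 0) ∧
    FQCE N K φ ν z (-(N:ℤ)) = η a + 2*η (2*a) ∧
    FQCE N K φ ν z ((N:ℤ)+1) = -(η a + 2*η (2*a)) ∧
    FQCE N K φ ν z (-(K:ℤ)-1) = (1/2)*η (2*a) ∧
    FQCE N K φ ν z (-(K:ℤ)) = -(1/2)*η (2*a) ∧
    FQCE N K φ ν z (-(K:ℤ)+1) = -(1/2)*η (2*a) ∧
    FQCE N K φ ν z (-(K:ℤ)+2) = (1/2)*η (2*a) ∧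
    FQCE N K φ ν z ((K:ℤ)-1) = -(1/2)*η (2*a) ∧
    FQCE N K φ ν z (K:ℤ) = (1/2)*η (2*a) ∧
    FQCE N K φ ν z ((K:ℤ)+1) = (1/2)*η (2*a) ∧
    FQCE N K φ ν z ((K:ℤ)+2) = -(1/2)*η (2*a) ∧
    (η (2*a) ≠ 0 → FQCE N K φ ν z (-(K:ℤ)-1) ≠ 0) := by
  have hdiff : ∀ x : ℝ, 0 < x → DifferentiableAt ℝ φ x := fun x hx =>
    (hφ.differentiableOn (by norm_num)).differentiableAt (Ioi_mem_nhds hx)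
  have hF := fun (j : ℤ) (hj : -(N:ℤ) ≤ j ∧ j ≤ N + 1) =>
    FQCE_uniform N K hKN hν hν1 (hdiff a ha) (hdiff (2 * a) (by positivity)) hz hj
  subst hη
  have hghost : FQCE N K φ ν z (-(K:ℤ)-1) = (1/2) * deriv φ (2*a) := by
    rw [hF _ (by omega), etaHat]
    simp (disch := omega) only [if_pos, if_neg]
    ring
  refine ⟨fun j hj => ?_, ?_, ?_, hghost, ?_, ?_, ?_, ?_, ?_, ?_, ?_, fun h => ?_⟩
  case refine_1 =>
    rcases hj with hj | hj | hj <;>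
    · rw [hF _ (by omega), etaHat]
      simp (disch := omega) only [if_pos, if_neg]
      ring
  case refine_11 =>
    rw [hghost]
    positivity
  all_goals
    rw [hF _ (by omega), etaHat]
    simp (disch := omega) only [if_pos, if_neg, if_true]
    ring
end
end
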